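/- arXiv:2209.04657 — 2 statements merged into one kernel-verified Lean document; each statement's English description precedes it below -/
import Mathlib

section
/- The constant ν_1 is irrational, and its irrationality measure is at least 2: for every real number κ < 2 there are infinitely many pairs of integers (p,q) with q > 0 such that 0 < |ν_1 − p/q| < 1/q^κ. -/
open List Filter

open scoped Classical

noncomputable section

/-- The curling number of a finite string: the largest `k` such that
`S = X ++ Y^k` with `Y` nonempty; by convention `curl [] = 1`. -/
def curl (S : List ℕ) : ℕ :=
  max 1 (sSup {k | ∃ X Y : List ℕ, Y ≠ [] ∧ S = X ++ (List.replicate k Y).flatten})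

/-- The prefix of length `n` of the level-`m` Gijswijt sequence `A^(m)`. -/
def gPrefix (m : ℕ) : ℕ → List ℕ
  | 0 => []
  | n + 1 => gPrefix m n ++ [max m (curl (gPrefix m n))]

/-- `gij m p` is the `p`-th term (1-indexed) of the level-`m` Gijswijt sequence `A^(m)`. -/
def gij (m p : ℕ) : ℕ := max m (curl (gPrefix m (p - 1)))

/-- Standing hypothesis: for every `m ≥ 1`, the sets
`{k ≥ 0 : C(A^(m)[1,k]) ≤ m}` and `{k ≥ 0 : C(A^(m+1)[1,k]) ≤ m}` are infinite. -/
def StandingHyp : Prop :=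
  ∀ m : ℕ, 1 ≤ m →
    {k : ℕ | curl (gPrefix m k) ≤ m}.Infinite ∧
    {k : ℕ | curl (gPrefix (m + 1) k) ≤ m}.Infinite

/-- Length of `π^(m)(1,x)`: the `x`-th smallest (0-indexed) element of
`{k : C(A^(m)[1,k]) ≤ m}`. -/
def piLen (m x : ℕ) : ℕ := Nat.nth (fun k => curl (gPrefix m k) ≤ m) x

/-- `π^(m)(1,x)`: the prefix of `A^(m)` with exactly `x` occurrences of `m`
and curling number at most `m`. -/
def piStr (m x : ℕ) : List ℕ := gPrefix m (piLen m x)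

/-- `β^(m)(t)`, the length of `B_t^(m)`. -/
def beta (m t : ℕ) : ℕ := piLen m ((m + 1) ^ (t - 1))

/-- `B_t^(m) := π^(m)(1,(m+1)^(t-1))`. -/
def Bstr (m t : ℕ) : List ℕ := piStr m ((m + 1) ^ (t - 1))

/-- `τ^(m)(t)`, the length of `T_t^(m)`. -/
def tau (m t : ℕ) : ℕ := Nat.nth (fun k => curl (gPrefix (m + 1) k) ≤ m) (t - 1)

/-- `T_t^(m)`: the `t`-th shortest prefix of `A^(m+1)` with curling number at most `m`. -/
def Tstr (m t : ℕ) : List ℕ := gPrefix (m + 1) (tau m t)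

/-- `φ^(m)(n)`: the least `p ≥ 1` with `A^(m)(p) = n`. -/
def phi (m n : ℕ) : ℕ := sInf {p : ℕ | 1 ≤ p ∧ gij m p = n}

/-- `t^(m)(n) = 1 + log_{m+1} #\{i ≤ φ^(m)(n) : A^(m)(i) = m\}`. -/
def tfun (m n : ℕ) : ℕ := 1 + Nat.log (m + 1) ((gPrefix m (phi m n)).count m)

/-- `χ^(b)(a)`: read the base-`b` digits of `a` as base-`(b+1)` digits. -/
def chi (b a : ℕ) : ℕ := Nat.ofDigits (b + 1) (Nat.digits b a)

/-- `ι_m(t)`: read the base-`(m+2)` digits of the number of occurrences of `m+1`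
in `T_t^(m)` as base-`(m+1)` digits. -/
def iota (m t : ℕ) : ℕ :=
  Nat.ofDigits (m + 1) (Nat.digits (m + 2) ((Tstr m t).count (m + 1)))

/-- `ι_m⁻¹(p)`: the largest `x ≥ 1` with `ι_m(x) ≤ p`. -/
def iotaInv (m p : ℕ) : ℕ := sSup {x : ℕ | 1 ≤ x ∧ iota m x ≤ p}

/-- `ord_b(n)`: the `b`-adic valuation of `n`. -/
def ordb (b n : ℕ) : ℕ := sSup {z : ℕ | b ^ z ∣ n}

/-- The largest base-`b` digit of `n`. -/
def maxdigit (b n : ℕ) : ℕ := (Nat.digits b n).foldr max 0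

/-- Auxiliary function for the level-`m` expansion: `lexpAux m a k = a_{m+1+k}`. -/
def lexpAux (m a : ℕ) : ℕ → ℕ
  | 0 => a
  | k + 1 => iota (m + 1 + k) (ordb (m + 1 + k) (lexpAux m a k) + 1)

/-- `lexp m a l = a_l`, the `l`-th term of the level-`m` expansion of `a`. -/
def lexp (m a l : ℕ) : ℕ := lexpAux m a (l - (m + 1))

/-- The last element `n` of `π^(m+1)(1, χ^(m+1)(a))`; the level-`m` expansion
of `a` is `a_{m+1}, …, a_n`. -/
def levelEnd (m a : ℕ) : ℕ := (piStr (m + 1) (chi (m + 1) a)).getLastD 0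

/-- `V_m := {v ≥ 0 : C(T_{v+1}^(m+1)) ≤ m}`. -/
def Vset (m : ℕ) : Set ℕ := {v | curl (Tstr (m + 1) (v + 1)) ≤ m}

/-- `Q := {α ≥ 0 : C(T_{α+1}^(2)) = 1}`. -/
def Qset : Set ℕ := {a | curl (Tstr 2 (a + 1)) = 1}

/-- `R := {(a,b) : a ∈ Q, a < b, no suffix S of T_{a+1}^(2) with T_{a+1}^(2)·S = T_{b+1}^(2)}`. -/
def Rset : Set (ℕ × ℕ) :=
  {p | p.1 ∈ Qset ∧ p.1 < p.2 ∧
    ¬∃ S : List ℕ, S <:+ Tstr 2 (p.1 + 1) ∧ Tstr 2 (p.1 + 1) ++ S = Tstr 2 (p.2 + 1)}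

/-- The digit of `x` in base `b` at (1-indexed) position `i`, i.e. the coefficient
of `b^(i-1)`. -/
def digitAt (b x i : ℕ) : ℕ := (Nat.digits b x).getD (i - 1) 0

/-- `u` is the (1-indexed) position of the second nonzero base-`b` digit of `x`
(the first nonzero digit being at position `ord_b(x)+1`). -/
def IsSecondNonzero (b x u : ℕ) : Prop :=
  ordb b x + 1 < u ∧ digitAt b x u ≠ 0 ∧
    ∀ i, ordb b x + 1 < i → i < u → digitAt b x i = 0

/-- `𝒮_b`: pairs `(a,a')` with `1 ≤ a < a'` such that for some position `y` the
base-`b` digits of `a` and `a'` agree away from `y` and twice the `y`-th digit of `a`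
is at least the `y`-th digit of `a'`. -/
def Sset (b : ℕ) : Set (ℕ × ℕ) :=
  {p | 1 ≤ p.1 ∧ p.1 < p.2 ∧
    ∃ y : ℕ, (∀ i, i ≠ y → (Nat.digits b p.1).getD i 0 = (Nat.digits b p.2).getD i 0) ∧
      (Nat.digits b p.2).getD y 0 ≤ 2 * (Nat.digits b p.1).getD y 0}

/-- The glue string `S_t^(m)`, so that `T_{t+1}^(m) = T_t^(m) ++ glue m t`. -/
def glue (m t : ℕ) : List ℕ := (gPrefix (m + 1) (tau m (t + 1))).drop (tau m t)

/-- The strings `P_t^(m)`: `P_1^(m) = (m)` and `P_{t+1}^(m) = P_t^(m)·B_t^(m)·S_t^(m)`. -/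
def Pstr (m : ℕ) : ℕ → List ℕ
  | 0 => []
  | 1 => [m]
  | t + 2 => Pstr m (t + 1) ++ Bstr m (t + 1) ++ glue m (t + 1)

end

namespace Gijswijt

/-- `S` has a suffix of the form `Y^k` with `Y` nonempty. -/
def HasPow (S : List ℕ) (k : ℕ) : Prop :=
  ∃ X Y : List ℕ, Y ≠ [] ∧ S = X ++ (List.replicate k Y).flatten

theorem HasPow.mono {S : List ℕ} {k l : ℕ} (h : HasPow S l) (hkl : k ≤ l) : HasPow S k := by
  obtain ⟨X, Y, hY, rfl⟩ := h
  refine ⟨X ++ (List.replicate (l - k) Y).flatten, Y, hY, ?_⟩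
  rw [List.append_assoc, ← List.flatten_append, List.replicate_append_replicate]
  congr 4
  omega

theorem HasPow.of_suffix {S S' : List ℕ} {k : ℕ} (h : HasPow S k) (hs : S <:+ S') :
    HasPow S' k := by
  obtain ⟨X, Y, hY, rfl⟩ := h
  obtain ⟨U, rfl⟩ := hs
  exact ⟨U ++ X, Y, hY, by simp⟩

theorem HasPow.le_length {S : List ℕ} {k : ℕ} (h : HasPow S k) : k ≤ S.length := by
  obtain ⟨X, Y, hY, rfl⟩ := h
  have : 1 ≤ Y.length := List.length_pos_iff.2 hY
  simp only [List.length_append, List.length_flatten, List.map_replicate, List.sum_replicate,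
    smul_eq_mul]
  nlinarith

theorem le_curl_iff {S : List ℕ} {k : ℕ} (hk : 2 ≤ k) : k ≤ curl S ↔ HasPow S k := by
  have hb : BddAbove {k | HasPow S k} := ⟨S.length, fun _ h => h.le_length⟩
  have hne : {k | HasPow S k}.Nonempty := ⟨0, S, [0], by simp, by simp⟩
  have hc : curl S = max 1 (sSup {k | HasPow S k}) := rfl
  rw [hc]
  constructor
  · intro h
    have h2 : k ≤ sSup {k | HasPow S k} := by
      rcases le_max_iff.1 h with h | h
      · omega
      · exact h
    exact HasPow.mono (Nat.sSup_mem hne hb) h2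
  · intro h
    exact le_max_of_le_right (le_csSup hb h)

theorem curl_lt_iff {S : List ℕ} {k : ℕ} (hk : 2 ≤ k) : curl S < k ↔ ¬ HasPow S k := by
  rw [← le_curl_iff hk, not_le]

theorem curl_nil : curl [] = 1 := by
  refine le_antisymm ?_ (le_max_left _ _)
  have := (curl_lt_iff (S := []) (k := 2) le_rfl).2 (fun h => by simpa using h.le_length)
  omega

theorem curl_mono_suffix {S S' : List ℕ} (hs : S <:+ S') : curl S ≤ curl S' := by
  by_cases h : 2 ≤ curl S
  · exact (le_curl_iff h).2 (((le_curl_iff h).1 le_rfl).of_suffix hs)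
  · exact (show curl S ≤ 1 by omega).trans (le_max_left _ _)

theorem two_le_curl_of_square (X Y : List ℕ) (hY : Y ≠ []) : 2 ≤ curl (X ++ Y ++ Y) :=
  (le_curl_iff le_rfl).2 ⟨X, Y, hY, by simp [List.replicate]⟩

/-! ### Blocks between occurrences of a letter, counted from the right -/

/-- The blocks of the reversal of `S` delimited by the letter `m`. -/
def rblk (m : ℕ) : List ℕ → ℕ → List ℕ
  | [], _ => []
  | a :: L, 0 => if a = m then [] else rblk m L 0 ++ [a]
  | a :: L, i + 1 => if a = m then rblk m L i else rblk m L (i + 1)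

/-- The `i`-th block (from the right, starting at `0`) of `S` delimited by the letter `m`. -/
def blk (m : ℕ) (S : List ℕ) (i : ℕ) : List ℕ := rblk m S.reverse i

theorem rblk_append (m : ℕ) (A B : List ℕ) (i : ℕ) :
    rblk m (A ++ B) i = if i < A.count m then rblk m A i
      else if i = A.count m then rblk m B 0 ++ rblk m A i else rblk m B (i - A.count m) := by
  induction A generalizing i with
  | nil =>
    rcases i with _ | i <;> simp [rblk]
  | cons a A ih =>
    rcases i with _ | i
    · by_cases h : a = m
      · simp [rblk, h]
      · simp only [List.cons_append, rblk, h, if_false, ih, List.count_cons_of_ne h]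
        split_ifs with h1 h2
        · rfl
        · simp
        · omega
    · by_cases h : a = m
      · subst h
        simp only [List.cons_append, rblk, if_true, ih, List.count_cons_self]
        simp
      · simp only [List.cons_append, rblk, h, if_false, ih, List.count_cons_of_ne h]

theorem blk_append_lt {m : ℕ} {Y : List ℕ} (Z : List ℕ) {i : ℕ} (h : i < Y.count m) :
    blk m (Z ++ Y) i = blk m Y i := by
  simp [blk, rblk_append, h]

theorem blk_append_count (m : ℕ) (Z Y : List ℕ) :
    blk m (Z ++ Y) (Y.count m) = blk m Z 0 ++ blk m Y (Y.count m) := by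
  simp [blk, rblk_append]

theorem blk_append_add (m : ℕ) (Z Y : List ℕ) {i : ℕ} (h : 0 < i) :
    blk m (Z ++ Y) (Y.count m + i) = blk m Z i := by
  simp [blk, rblk_append, h.ne']

theorem rblk_of_notMem {m : ℕ} {E : List ℕ} (h : m ∉ E) : rblk m E 0 = E.reverse := by
  induction E with
  | nil => rfl
  | cons a E ih =>
    simp only [List.mem_cons, not_or] at h
    simp [rblk, Ne.symm h.1, ih h.2]

theorem blk_cons_zero {m : ℕ} (U : List ℕ) {E : List ℕ} (h : m ∉ E) :
    blk m (U ++ m :: E) 0 = E := by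
  have hc : E.count m = 0 := List.count_eq_zero.2 h
  simp [blk, rblk_append, hc, rblk, rblk_of_notMem (m := m) (E := E.reverse) (by simpa using h)]

theorem blk_cons_succ {m : ℕ} (U : List ℕ) {E : List ℕ} (h : m ∉ E) (i : ℕ) :
    blk m (U ++ m :: E) (i + 1) = blk m U i := by
  have hc : E.count m = 0 := List.count_eq_zero.2 h
  simp [blk, rblk_append, hc, rblk]

theorem count_pow (m k : ℕ) (Y : List ℕ) :
    ((List.replicate k Y).flatten).count m = k * Y.count m := by
  simp [List.count_flatten]

section Power

variable {m k : ℕ} {Y : List ℕ} (Z : List ℕ)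

theorem blk_pow_zero (hn : 0 < Y.count m) (hk : 0 < k) :
    blk m (Z ++ (List.replicate k Y).flatten) 0 = blk m Y 0 := by
  obtain ⟨k, rfl⟩ := Nat.exists_eq_succ_of_ne_zero hk.ne'
  rw [List.replicate_succ', List.flatten_append, ← List.append_assoc]
  simp only [List.flatten_cons, List.flatten_nil, List.append_nil]
  exact blk_append_lt _ hn

theorem pow_split {l : ℕ} (hl : l ≤ k) : Z ++ (List.replicate k Y).flatten =
    (Z ++ (List.replicate (k - l) Y).flatten) ++ (List.replicate l Y).flatten := by
  rw [List.append_assoc, ← List.flatten_append, List.replicate_append_replicate]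
  congr 4
  omega

theorem blk_pow_add {l i : ℕ} (hl : l < k) (hi : 0 < i) (hin : i < Y.count m) :
    blk m (Z ++ (List.replicate k Y).flatten) (l * Y.count m + i) = blk m Y i := by
  rw [pow_split Z hl.le, ← count_pow, blk_append_add _ _ _ hi]
  obtain ⟨d, hd⟩ : ∃ d, k - l = d + 1 := ⟨k - l - 1, by omega⟩
  rw [hd, List.replicate_succ', List.flatten_append, ← List.append_assoc]
  simp only [List.flatten_cons, List.flatten_nil, List.append_nil]
  exact blk_append_lt _ hin

theorem blk_pow_self {l : ℕ} (hn : 0 < Y.count m) (hl : 0 < l) :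
    blk m (List.replicate l Y).flatten (l * Y.count m) = blk m Y (Y.count m) := by
  obtain ⟨l, rfl⟩ := Nat.exists_eq_succ_of_ne_zero hl.ne'
  rw [List.replicate_succ, List.flatten_cons, Nat.succ_mul, ← count_pow,
    blk_append_add _ _ _ hn]

theorem blk_pow_mul {l : ℕ} (hn : 0 < Y.count m) (hl : 0 < l) (hlk : l ≤ k) :
    blk m (Z ++ (List.replicate k Y).flatten) (l * Y.count m) =
      blk m (Z ++ (List.replicate (k - l) Y).flatten) 0 ++ blk m Y (Y.count m) := by
  rw [pow_split Z hlk, ← blk_pow_self hn hl, ← count_pow, blk_append_count]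

end Power

theorem suffix_of_notMem {m : ℕ} {U E Q : List ℕ} (hQ : m ∉ Q) (h : Q <:+ U ++ m :: E) :
    Q <:+ E := by
  have h2 : m :: E <:+ U ++ m :: E := List.suffix_append _ _
  rcases List.suffix_or_suffix_of_suffix h h2 with h3 | h3
  · rcases List.suffix_cons_iff.1 h3 with rfl | h4
    · simp at hQ
    · exact h4
  · exact absurd (h3.subset (by simp)) hQ

/-- The concatenation of the strings `m :: g i` for `1 ≤ i ≤ N`. -/
def chain (m : ℕ) (g : ℕ → List ℕ) : ℕ → List ℕ
  | 0 => []
  | i + 1 => chain m g i ++ m :: g (i + 1)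

theorem blk_chain {m : ℕ} {g : ℕ → List ℕ} (hg : ∀ i, m ∉ g i) {N i : ℕ} (hi : i < N) :
    blk m (chain m g N) i = g (N - i) := by
  induction N generalizing i with
  | zero => omega
  | succ N ih =>
    rcases i with _ | i
    · exact blk_cons_zero _ (hg _)
    · rw [chain, blk_cons_succ _ (hg _), ih (by omega)]
      congr 1
      omega

theorem blk_chain_self {m : ℕ} {g : ℕ → List ℕ} (hg : ∀ i, m ∉ g i) (N : ℕ) :
    blk m (chain m g N) N = [] := by
  induction N with
  | zero => rfl
  | succ N ih => rw [chain, blk_cons_succ _ (hg _), ih]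

theorem count_chain {m : ℕ} {g : ℕ → List ℕ} (hg : ∀ i, m ∉ g i) (N : ℕ) :
    (chain m g N).count m = N := by
  induction N with
  | zero => rfl
  | succ N ih => simp [chain, ih, List.count_eq_zero.2 (hg _)]

/-- Periodicity of the blocks of a string `m g(1) m g(2) ⋯ m g(N) m E` having a power as suffix. -/
theorem chain_pow {m N k : ℕ} {g : ℕ → List ℕ} {E Z Y : List ℕ} (hg : ∀ i, m ∉ g i)
    (hE : m ∉ E) (h : chain m g N ++ m :: E = Z ++ (List.replicate k Y).flatten)
    (hn : 0 < Y.count m) (hk : 2 ≤ k) :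
    k * Y.count m ≤ N + 1 ∧
    (∀ l i, l < k → 0 < i → i < Y.count m → g (N + 1 - (l * Y.count m + i)) = g (N + 1 - i)) ∧
    ∃ P, (∀ l, 0 < l → l < k → g (N + 1 - l * Y.count m) = E ++ P) ∧
      (k * Y.count m = N + 1 → P = []) ∧
      (k * Y.count m < N + 1 → P <:+ g (N + 1 - k * Y.count m)) := by
  set n := Y.count m with hndef
  have hcount : N + 1 = Z.count m + k * n := by
    have := congrArg (List.count m) h
    simpa [count_chain hg, List.count_eq_zero.2 hE, count_pow] using this
  have hb : ∀ i, 0 < i → i < N + 1 →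
      blk m (Z ++ (List.replicate k Y).flatten) i = g (N + 1 - i) := by
    intro i hi hiN
    obtain ⟨i, rfl⟩ := Nat.exists_eq_succ_of_ne_zero hi.ne'
    rw [← h, Nat.succ_eq_add_one, blk_cons_succ _ hE, blk_chain hg (by omega)]
    congr 1
    omega
  have hkn : k * n ≤ N + 1 := by omega
  have hlt : ∀ l i, l < k → i < n → l * n + i < N + 1 := by
    intro l i hl hi
    have : (l + 1) * n ≤ k * n := Nat.mul_le_mul_right _ hl
    nlinarith
  refine ⟨hkn, ?_, blk m Y n, ?_, ?_, ?_⟩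
  · intro l i hl hi hin
    rw [← hb _ (by omega) (hlt l i hl hin), blk_pow_add Z hl hi hin]
    have := hlt 0 i (by omega) hin
    rw [← hb i hi (by omega), ← blk_pow_add Z (l := 0) (k := k) (by omega) hi hin]
    simp
  · intro l hl hlk
    have h0 : blk m (chain m g N ++ m :: E) 0 = E := blk_cons_zero _ hE
    rw [h, blk_pow_zero Z hn (by omega)] at h0
    have := hlt l 0 hlk hn
    rw [← hb _ (Nat.mul_pos hl hn) (by omega), blk_pow_mul Z hn hl hlk.le,
      blk_pow_zero Z hn (by omega), h0]
  · intro hkN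
    have h1 : blk m (chain m g N ++ m :: E) (N + 1) = [] := by
      rw [blk_cons_succ _ hE, blk_chain_self hg]
    rw [h, ← hkN, blk_pow_mul Z hn (by omega) le_rfl] at h1
    exact (List.append_eq_nil_iff.1 h1).2
  · intro hkN
    rw [← hb _ (Nat.mul_pos (by omega) hn) hkN, blk_pow_mul Z hn (by omega) le_rfl]
    exact List.suffix_append _ _

theorem hasPow_cons_cases {m k : ℕ} {U E : List ℕ} (h : HasPow (U ++ m :: E) k) :
    HasPow E k ∨ ∃ Z Y, 0 < Y.count m ∧ U ++ m :: E = Z ++ (List.replicate k Y).flatten := by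
  obtain ⟨Z, Y, hY, h⟩ := h
  rcases Nat.eq_zero_or_pos (Y.count m) with h0 | h0
  · left
    have hQ : m ∉ (List.replicate k Y).flatten := by
      rw [← List.count_eq_zero, count_pow, h0, mul_zero]
    obtain ⟨Z', hZ'⟩ := suffix_of_notMem (U := U) (E := E) hQ
      (by rw [h]; exact List.suffix_append _ _)
    exact ⟨Z', Y, hY, hZ'.symm⟩
  · exact Or.inr ⟨Z, Y, h0, h⟩

/-! ### Valuations along arithmetic progressions -/

theorem pow_dvd_iff {b n t : ℕ} (hb : 2 ≤ b) (hn : 0 < n) :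
    b ^ t ∣ n ↔ t ≤ multiplicity b n :=
  (Nat.finiteMultiplicity_iff.2 ⟨by omega, hn⟩).pow_dvd_iff_le_multiplicity

theorem multiplicity_eq_of {b n n' : ℕ} (hb : 2 ≤ b) (hn : 0 < n) (hn' : 0 < n')
    (h : ∀ t, b ^ t ∣ n ↔ b ^ t ∣ n') : multiplicity b n = multiplicity b n' :=
  le_antisymm ((pow_dvd_iff hb hn').1 ((h _).1 ((pow_dvd_iff hb hn).2 le_rfl)))
    ((pow_dvd_iff hb hn).1 ((h _).2 ((pow_dvd_iff hb hn').2 le_rfl)))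

theorem multiplicity_eq_iff {b n j : ℕ} (hb : 2 ≤ b) (hn : 0 < n) :
    multiplicity b n = j ↔ b ^ j ∣ n ∧ ¬ b ^ (j + 1) ∣ n := by
  rw [pow_dvd_iff hb hn, pow_dvd_iff hb hn]
  omega

theorem multiplicity_window {b n k X : ℕ} (hb : 2 ≤ b) (hk : 2 ≤ k) (hn : 0 < n)
    (hkn : k * n ≤ X)
    (H : ∀ l i, l < k → 0 < i → i < n →
      multiplicity b (X - (l * n + i)) = multiplicity b (X - i)) :
    ∃ j, b ^ j ∣ n ∧ ¬ b ^ (j + 1) ∣ n ∧ n < b ^ (j + 1) ∧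
      ∀ r, 0 < r → r < k * n → b ^ (j + 1) ∣ X - r → ∃ l, 0 < l ∧ l < k ∧ r = l * n := by
  obtain ⟨h1, h2⟩ := (multiplicity_eq_iff hb hn).1 rfl
  set j := multiplicity b n
  have key : ∀ r, 0 < r → r < k * n → b ^ (j + 1) ∣ X - r → ∃ l, 0 < l ∧ l < k ∧ r = l * n := by
    intro r hr hrk hd
    have hl : r / n < k := Nat.div_lt_of_lt_mul (by linarith [mul_comm k n])
    have hr' : r / n * n + r % n = r := by rw [mul_comm]; exact Nat.div_add_mod r n
    rcases Nat.eq_zero_or_pos (r % n) with h0 | h0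
    · refine ⟨r / n, ?_, hl, by omega⟩
      rcases Nat.eq_zero_or_pos (r / n) with h | h
      · simp [h] at hr'; omega
      · exact h
    · exfalso
      have hin := Nat.mod_lt r hn
      have e1 := H _ _ hl h0 hin
      have e2 := H 1 _ (by omega) h0 hin
      have h2n : 2 * n ≤ k * n := Nat.mul_le_mul_right _ hk
      rw [hr'] at e1
      have d0 := (pow_dvd_iff hb (by omega)).1 hd
      have d1 := (pow_dvd_iff hb (by omega)).2 (e1 ▸ d0)
      have d2 := (pow_dvd_iff hb (by omega)).2 (e2 ▸ e1 ▸ d0)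
      apply h2
      have := Nat.dvd_sub d1 d2
      rwa [show X - r % n - (X - (1 * n + r % n)) = n by omega] at this
  refine ⟨j, h1, h2, ?_, key⟩
  by_contra hlt
  set M := b ^ (j + 1)
  have hM : 0 < M := Nat.pow_pos (by omega)
  have hnM : M < n := lt_of_le_of_ne (not_lt.1 hlt) (fun h => h2 (h ▸ dvd_rfl))
  have hnk : n ≤ k * n := Nat.le_mul_of_pos_left _ (by omega)
  obtain ⟨r, hr0, hrM, hrd⟩ : ∃ r, 0 < r ∧ r ≤ M ∧ M ∣ X - r := by
    rcases Nat.eq_zero_or_pos (X % M) with h | h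
    · exact ⟨M, hM, le_rfl, Nat.dvd_sub (Nat.dvd_of_mod_eq_zero h) dvd_rfl⟩
    · exact ⟨X % M, h, (Nat.mod_lt _ hM).le, Nat.dvd_sub_mod _⟩
  obtain ⟨l, hl, -, rfl⟩ := key r hr0 (by omega) hrd
  have : n ≤ l * n := Nat.le_mul_of_pos_left _ hl
  omega

/-! ### The prefixes of `A^(m+1)` of small curling number -/

theorem length_gPrefix (m n : ℕ) : (gPrefix m n).length = n := by
  induction n with
  | zero => rfl
  | succ n ih => simp [gPrefix, ih]

theorem le_of_mem_gPrefix {m n a : ℕ} (h : a ∈ gPrefix m n) : m ≤ a := by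
  induction n with
  | zero => simp [gPrefix] at h
  | succ n ih =>
    rcases List.mem_append.1 h with h | h
    · exact ih h
    · rw [List.mem_singleton.1 h]
      exact le_max_left _ _

/-- The prefixes of `A^(m+1)` of curling number at most `m`, indexed from `0`. -/
noncomputable def T (m j : ℕ) : List ℕ := Tstr m (j + 1)

/-- The number of prefixes of `A^(m+1)` of curling number at most `m` is infinite. -/
def InfT (m : ℕ) : Prop := {k : ℕ | curl (gPrefix (m + 1) k) ≤ m}.Infinite

theorem T_eq (m j : ℕ) :
    T m j = gPrefix (m + 1) (Nat.nth (fun k => curl (gPrefix (m + 1) k) ≤ m) j) := rfl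

theorem notMem_T (m j : ℕ) : m ∉ T m j := fun h => by
  have := le_of_mem_gPrefix h
  omega

theorem T_zero {m : ℕ} (hm : 1 ≤ m) : T m 0 = [] := by
  rw [T_eq, Nat.nth_zero_of_zero]
  · rfl
  · simpa [gPrefix, curl_nil] using hm

section

variable {m : ℕ} (hT : InfT m)

include hT

theorem curl_T (j : ℕ) : curl (T m j) ≤ m := Nat.nth_mem_of_infinite hT j

theorem length_T_strictMono : StrictMono fun j => (T m j).length := by
  intro i j hij
  simp only [T_eq, length_gPrefix]
  exact Nat.nth_strictMono hT hij

theorem T_injective {i j : ℕ} (h : T m i = T m j) : i = j :=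
  (length_T_strictMono hT).injective (congrArg List.length h)

theorem le_of_T_append {i j : ℕ} {P : List ℕ} (h : T m i = T m j ++ P) : j ≤ i := by
  refine (length_T_strictMono hT).le_iff_le.1 ?_
  simp [h]

end

/-- The block following the `i`-th occurrence of `m` in `A^(m)`. -/
noncomputable def gl (m i : ℕ) : List ℕ := T m (multiplicity (m + 1) i)

/-- The prefix of `A^(m)` consisting of `m` and the following block, `N` times. -/
noncomputable def W (m N : ℕ) : List ℕ := chain m (gl m) N

theorem W_succ (m N : ℕ) : W m (N + 1) = W m N ++ m :: gl m (N + 1) := rfl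

theorem notMem_gl (m i : ℕ) : m ∉ gl m i := notMem_T _ _

theorem count_W (m N : ℕ) : (W m N).count m = N := count_chain (notMem_gl m) N

/-- A power with exponent at least two at the end of `W N ++ m :: E` in which the base contains
`m` imposes strong restrictions. -/
theorem W_pow {m N k : ℕ} {E Z Y : List ℕ} (hm : 1 ≤ m) (hT : InfT m) (hE : m ∉ E)
    (h : W m N ++ m :: E = Z ++ (List.replicate k Y).flatten)
    (hn : 0 < Y.count m) (hk : 2 ≤ k) :
    k * Y.count m ≤ N + 1 ∧
    (∀ i, 0 < i → i < Y.count m →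
      multiplicity (m + 1) (N + 1 - (Y.count m + i)) = multiplicity (m + 1) (N + 1 - i)) ∧
    (∃ j, (m + 1) ^ j ∣ Y.count m ∧ ¬ (m + 1) ^ (j + 1) ∣ Y.count m ∧
      Y.count m < (m + 1) ^ (j + 1) ∧
      ∀ r, 0 < r → r < k * Y.count m → (m + 1) ^ (j + 1) ∣ N + 1 - r →
        ∃ l, 0 < l ∧ l < k ∧ r = l * Y.count m) ∧
    ∃ P, (∀ l, 0 < l → l < k → gl m (N + 1 - l * Y.count m) = E ++ P) ∧
      (k * Y.count m = N + 1 → P = []) ∧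
      (k * Y.count m < N + 1 → P <:+ gl m (N + 1 - k * Y.count m)) := by
  obtain ⟨h1, h2, h3⟩ := chain_pow (notMem_gl m) hE h hn hk
  have h2' := fun l i hl hi hin => T_injective hT (h2 l i hl hi hin)
  refine ⟨h1, ?_, multiplicity_window (by omega) hk hn h1 h2', h3⟩
  intro i hi hin
  simpa using h2' 1 i (by omega) hi hin

/-- In a power of exponent at least three, no multiple of a large power of `m + 1` occurs. -/
theorem W_pow_three {m N k : ℕ} {E Z Y : List ℕ} (hm : 1 ≤ m) (hT : InfT m) (hE : m ∉ E)
    (h : W m N ++ m :: E = Z ++ (List.replicate k Y).flatten)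
    (hn : 0 < Y.count m) (hk : 3 ≤ k) :
    k * Y.count m ≤ N + 1 ∧
    ∃ j, (m + 1) ^ j ∣ Y.count m ∧
      (∀ r, 0 < r → r < k * Y.count m → ¬ (m + 1) ^ (j + 1) ∣ N + 1 - r) ∧
      ∃ P, gl m (N + 1 - Y.count m) = E ++ P := by
  obtain ⟨h1, -, ⟨j, hj, hj', -, hw⟩, P, hP, -⟩ := W_pow hm hT hE h hn (by omega)
  refine ⟨h1, j, hj, ?_, P, by simpa using hP 1 (by omega) (by omega)⟩
  intro r hr hrk hd
  obtain ⟨l, hl, hlk, rfl⟩ := hw r hr hrk hd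
  have h3 : 3 * Y.count m ≤ k * Y.count m := Nat.mul_le_mul_right _ hk
  have hpos : 0 < N + 1 - l * Y.count m := by
    have : l * Y.count m < k * Y.count m := Nat.mul_lt_mul_of_pos_right hlk hn
    omega
  have hd' := (pow_dvd_iff (by omega) hpos).1 hd
  have e1 := T_injective hT ((hP l hl hlk).trans (hP 1 (by omega) (by omega)).symm)
  have e2 := T_injective hT ((hP l hl hlk).trans (hP 2 (by omega) (by omega)).symm)
  have d1 := (pow_dvd_iff (by omega) (by omega)).2 (e1 ▸ hd')
  have d2 := (pow_dvd_iff (by omega) (by omega)).2 (e2 ▸ hd')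
  apply hj'
  have := Nat.dvd_sub d1 d2
  rwa [show N + 1 - 1 * Y.count m - (N + 1 - 2 * Y.count m) = Y.count m by omega] at this

theorem curl_W_succ_le {m N : ℕ} (hm : 2 ≤ m) (hT : InfT m) : curl (W m (N + 1)) ≤ m := by
  suffices h : curl (W m (N + 1)) < m + 1 from Nat.lt_succ_iff.1 h
  rw [curl_lt_iff (by omega), W_succ]
  intro hp
  rcases hasPow_cons_cases hp with h | ⟨Z, Y, hn, h⟩
  · have := (le_curl_iff (by omega)).2 h
    have := curl_T hT (multiplicity (m + 1) (N + 1))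
    simp only [gl] at *
    omega
  · obtain ⟨h1, j, hj, hw, P, hP⟩ :=
      W_pow_three (by omega) hT (notMem_gl _ _) h hn (by omega)
    set n := Y.count m
    have hM : 0 < (m + 1) ^ (j + 1) := Nat.pow_pos (by omega)
    have hMn : (m + 1) ^ (j + 1) ≤ (m + 1) * n := by
      rw [pow_succ, mul_comm]
      exact Nat.mul_le_mul_left _ (Nat.le_of_dvd hn hj)
    have h2n : 2 * n ≤ (m + 1) * n := Nat.mul_le_mul_right _ (by omega)
    rcases Nat.eq_zero_or_pos ((N + 1) % (m + 1) ^ (j + 1)) with h0 | h0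
    · have d1 := (pow_dvd_iff (by omega) (by omega)).1 (Nat.dvd_of_mod_eq_zero h0)
      have d2 := hw n hn (by omega)
      rw [pow_dvd_iff (by omega) (by omega)] at d2
      have := le_of_T_append hT hP
      omega
    · exact hw _ h0 ((Nat.mod_lt _ hM).trans_le hMn) (Nat.dvd_sub_mod _)

theorem curl_W_le {m : ℕ} (hm : 2 ≤ m) (hT : InfT m) (N : ℕ) : curl (W m N) ≤ m := by
  rcases N with _ | N
  · change curl [] ≤ m
    rw [curl_nil]
    omega
  · exact curl_W_succ_le hm hT

theorem hasPow_of_long {m N k : ℕ} {E : List ℕ} (hm : 2 ≤ m) (hT : InfT m) (hE : m ∉ E)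
    (hk : m + 2 ≤ k) (hp : HasPow (W m N ++ m :: E) k) : HasPow E k := by
  rcases hasPow_cons_cases hp with h | ⟨Z, Y, hn, h⟩
  · exact h
  · exfalso
    obtain ⟨h1, j, hj, hw, -⟩ := W_pow_three (by omega) hT hE h hn (by omega)
    set n := Y.count m
    have hM : 0 < (m + 1) ^ (j + 1) := Nat.pow_pos (by omega)
    have hMn : (m + 1) ^ (j + 1) ≤ (m + 1) * n := by
      rw [pow_succ, mul_comm]
      exact Nat.mul_le_mul_left _ (Nat.le_of_dvd hn hj)
    have hlt : (m + 1) * n < k * n := Nat.mul_lt_mul_of_pos_right (by omega) hn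
    rcases Nat.eq_zero_or_pos ((N + 1) % (m + 1) ^ (j + 1)) with h0 | h0
    · exact hw _ hM (by omega) (Nat.dvd_sub (Nat.dvd_of_mod_eq_zero h0) dvd_rfl)
    · exact hw _ h0 (((Nat.mod_lt _ hM).trans_le hMn).trans hlt) (Nat.dvd_sub_mod _)

/-! ### Self-similarity of `W` -/

theorem dvd_add_iff_of_lt {b s i j t : ℕ} (hs : b ^ j ∣ s) (hi : 0 < i)
    (hij : i < b ^ j) : b ^ t ∣ s + i ↔ b ^ t ∣ i := by
  have hj : ¬ b ^ j ∣ i := fun h => absurd (Nat.le_of_dvd hi h) (by omega)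
  rcases le_total t j with h | h
  · exact Nat.dvd_add_right ((pow_dvd_pow b h).trans hs)
  · refine ⟨fun h' => absurd ?_ hj, fun h' => absurd ((pow_dvd_pow b h).trans h') hj⟩
    exact (Nat.dvd_add_right hs).1 ((pow_dvd_pow b h).trans h')

theorem gl_add {m s i j : ℕ} (hm : 1 ≤ m) (hs : (m + 1) ^ j ∣ s) (hi : 0 < i)
    (hij : i < (m + 1) ^ j) : gl m (s + i) = gl m i := by
  rw [gl, gl, multiplicity_eq_of (by omega) (by omega) hi
    (fun t => dvd_add_iff_of_lt hs hi hij)]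

theorem W_add {m s j z : ℕ} (hm : 1 ≤ m) (hs : (m + 1) ^ j ∣ s) (hz : z < (m + 1) ^ j) :
    W m (s + z) = W m s ++ W m z := by
  induction z with
  | zero => simp [W, chain]
  | succ z ih =>
    rw [← add_assoc, W_succ, W_succ, ih (by omega), add_assoc, gl_add hm hs (by omega) hz]
    simp

theorem gl_eq {m x j : ℕ} (hm : 1 ≤ m) (hx : 0 < x) (h : (m + 1) ^ j ∣ x)
    (h' : ¬ (m + 1) ^ (j + 1) ∣ x) : gl m x = T m j := by
  rw [gl, (multiplicity_eq_iff (by omega) hx).2 ⟨h, h'⟩]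

theorem not_pow_succ_dvd_pow {b j : ℕ} (hb : 2 ≤ b) : ¬ b ^ (j + 1) ∣ b ^ j := fun h => by
  have := (Nat.pow_dvd_pow_iff_le_right (by omega)).1 h
  omega

theorem W_pow_eq {m j : ℕ} (hm : 1 ≤ m) :
    W m ((m + 1) ^ j) = W m ((m + 1) ^ j - 1) ++ m :: T m j := by
  have h : 0 < (m + 1) ^ j := Nat.pow_pos (by omega)
  obtain ⟨d, hd⟩ : ∃ d, (m + 1) ^ j = d + 1 := ⟨(m + 1) ^ j - 1, by omega⟩
  have := gl_eq hm h dvd_rfl (not_pow_succ_dvd_pow (j := j) (b := m + 1) (by omega))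
  rw [hd] at this ⊢
  rw [W_succ, this]
  simp

theorem W_add_pow {m s j : ℕ} (hm : 1 ≤ m) (hs : (m + 1) ^ j ∣ s) :
    W m (s + (m + 1) ^ j) = W m s ++ W m ((m + 1) ^ j - 1) ++ m :: gl m (s + (m + 1) ^ j) := by
  have h : 0 < (m + 1) ^ j := Nat.pow_pos (by omega)
  rw [← W_add hm hs (by omega)]
  conv_lhs => rw [show s + (m + 1) ^ j = (s + ((m + 1) ^ j - 1)) + 1 by omega, W_succ]
  rw [show s + ((m + 1) ^ j - 1) + 1 = s + (m + 1) ^ j by omega]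

theorem W_add_pow_of_not_dvd {m s j : ℕ} (hm : 1 ≤ m) (hs : (m + 1) ^ j ∣ s)
    (hs' : ¬ (m + 1) ^ (j + 1) ∣ s + (m + 1) ^ j) :
    W m (s + (m + 1) ^ j) = W m s ++ W m ((m + 1) ^ j) := by
  have h : 0 < (m + 1) ^ j := Nat.pow_pos (by omega)
  rw [W_add_pow hm hs, gl_eq hm (by omega) (dvd_add hs dvd_rfl) hs', W_pow_eq hm]
  simp

theorem W_add_mul_pow {m s j l : ℕ} (hm : 1 ≤ m) (hs : (m + 1) ^ (j + 1) ∣ s) (hl : l ≤ m) :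
    W m (s + l * (m + 1) ^ j) = W m s ++ (List.replicate l (W m ((m + 1) ^ j))).flatten := by
  induction l with
  | zero => simp
  | succ l ih =>
    have h : 0 < (m + 1) ^ j := Nat.pow_pos (by omega)
    rw [Nat.succ_mul, ← add_assoc, W_add_pow_of_not_dvd hm, ih (by omega), List.replicate_succ',
      List.flatten_append]
    · simp
    · exact dvd_add ((pow_dvd_pow _ (by omega)).trans hs) (dvd_mul_left _ _)
    · rw [add_assoc, Nat.dvd_add_right hs, ← Nat.succ_mul]
      intro hd
      have := Nat.le_of_dvd (by positivity) hd
      rw [pow_succ, mul_comm] at this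
      have := Nat.le_of_mul_le_mul_right this h
      omega

theorem hasPow_of_pow_dvd {m N i : ℕ} (hm : 1 ≤ m) (h : (m + 1) ^ (i + 1) ∣ N + 1) :
    HasPow (W m N ++ m :: T m i) (m + 1) := by
  obtain ⟨q, hq⟩ := h
  have hpos : 0 < (m + 1) ^ i := Nat.pow_pos (by omega)
  obtain ⟨q, rfl⟩ : ∃ q', q = q' + 1 := ⟨q - 1, by
    rcases q with _ | q
    · simp at hq
    · simp⟩
  have hN : N = ((m + 1) ^ (i + 1) * q + m * (m + 1) ^ i) + ((m + 1) ^ i - 1) := by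
    have : N + 1 = (m + 1) ^ (i + 1) * q + m * (m + 1) ^ i + (m + 1) ^ i := by
      rw [hq]; ring
    omega
  refine ⟨W m ((m + 1) ^ (i + 1) * q), W m ((m + 1) ^ i), ?_, ?_⟩
  · intro h
    rw [W_pow_eq hm] at h
    simp at h
  · rw [hN, W_add (j := i) hm, W_add_mul_pow hm (dvd_mul_right _ _) le_rfl,
      List.replicate_succ', List.flatten_append, W_pow_eq hm]
    · simp
    · exact dvd_add ((pow_dvd_pow _ (by omega)).trans (dvd_mul_right _ _)) (dvd_mul_left _ _)
    · omega

/-- A base-`(m+1)` digit at least two forces a square. -/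
theorem two_le_curl_W {m x j : ℕ} (hm : 1 ≤ m)
    (h : 2 * (m + 1) ^ j ≤ x % (m + 1) ^ (j + 1)) : 2 ≤ curl (W m x) := by
  set n := (m + 1) ^ j with hndef
  have hn : 0 < n := Nat.pow_pos (by omega)
  set r := x % (m + 1) ^ (j + 1) with hr
  have hx : (m + 1) ^ (j + 1) * (x / (m + 1) ^ (j + 1)) + r = x := Nat.div_add_mod _ _
  set s := (m + 1) ^ (j + 1) * (x / (m + 1) ^ (j + 1)) with hs
  have hrlt : r < (m + 1) * n := by
    have := Nat.mod_lt x (show 0 < (m + 1) ^ (j + 1) from Nat.pow_pos (by omega))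
    rwa [← hr, pow_succ, mul_comm] at this
  have hd : r / n ≤ m := by
    have := Nat.div_lt_of_lt_mul (show r < n * (m + 1) by linarith [mul_comm n (m + 1)])
    omega
  have hd2 : 2 ≤ r / n := (Nat.le_div_iff_mul_le hn).2 h
  have hrz : r / n * n + r % n = r := by rw [mul_comm]; exact Nat.div_add_mod r n
  have hz := Nat.mod_lt r hn
  obtain ⟨d, hd'⟩ : ∃ d, r / n = d + 2 := ⟨r / n - 2, by omega⟩
  have e1 : W m x = W m s ++ (List.replicate (r / n) (W m n)).flatten ++ W m (r % n) := by
    conv_lhs => rw [← hx, ← hrz, ← add_assoc]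
    rw [W_add (j := j) hm, W_add_mul_pow hm (dvd_mul_right _ _) hd]
    · exact dvd_add ((pow_dvd_pow _ (by omega)).trans (dvd_mul_right _ _)) (dvd_mul_left _ _)
    · exact hz
  have e2 : ∃ R, W m n = W m (r % n) ++ R := by
    refine ⟨(W m n).drop (W m (r % n)).length, ?_⟩
    have : ∀ k, W m (r % n) <+: W m (r % n + k) := by
      intro k
      induction k with
      | zero => exact List.prefix_rfl
      | succ k ih => exact ih.trans (List.prefix_append _ _)
    have := this (n - r % n)
    rw [show r % n + (n - r % n) = n by omega] at this
    exact (List.prefix_iff_eq_append.1 this).symm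
  obtain ⟨R, hR⟩ := e2
  have hne : R ++ W m (r % n) ≠ [] := by
    intro h
    have h1 := congrArg (List.count m) hR
    have h2 := congrArg (List.count m) h
    simp only [List.count_append, count_W, List.count_nil] at h1 h2
    omega
  rw [e1, hd', List.replicate_succ', List.replicate_succ']
  have := two_le_curl_of_square
    (W m s ++ (List.replicate d (W m n)).flatten ++ W m (r % n)) (R ++ W m (r % n)) hne
  convert this using 2
  simp only [List.flatten_append, List.flatten_cons, List.flatten_nil, List.append_nil,
    List.append_assoc]
  rw [hR]
  simp [List.append_assoc]

/-! ### The structure theorem -/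

theorem gPrefix_chain {m N : ℕ} (hm : 2 ≤ m) (hT : InfT m)
    (hN : gPrefix m (W m N).length = W m N) {r : ℕ}
    (hr : r ≤ (gl m (N + 1)).length) :
    gPrefix m ((W m N).length + 1 + r) = W m N ++ m :: gPrefix (m + 1) r := by
  induction r with
  | zero =>
    rw [add_zero]
    change gPrefix m (W m N).length ++ [_] = _
    rw [hN, max_eq_left (curl_W_le hm hT N)]
    rfl
  | succ r ih =>
    have hE : m ∉ gPrefix (m + 1) r := fun h => by
      have := le_of_mem_gPrefix h
      omega
    rw [← add_assoc, gPrefix, ih (by omega), gPrefix]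
    have hle : curl (gPrefix (m + 1) r) ≤ curl (W m N ++ m :: gPrefix (m + 1) r) :=
      curl_mono_suffix ⟨W m N ++ [m], by simp⟩
    have h1 : m + 1 ≤ curl (W m N ++ m :: gPrefix (m + 1) r) := by
      by_cases hc : m + 1 ≤ curl (gPrefix (m + 1) r)
      · exact hc.trans hle
      · rw [le_curl_iff (by omega)]
        have hc' : curl (gPrefix (m + 1) r) ≤ m := by omega
        set p := fun k => curl (gPrefix (m + 1) k) ≤ m with hp
        have hrT : gPrefix (m + 1) r = T m (Nat.count p r) := by
          rw [T_eq, Nat.nth_count (p := p) hc']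
        rw [hrT]
        apply hasPow_of_pow_dvd (by omega)
        rw [pow_dvd_iff (by omega) (by omega)]
        have := congrArg List.length hrT
        rw [length_gPrefix] at this
        apply (length_T_strictMono hT).lt_iff_lt.1
        rw [← this]
        exact hr
    have h2 : max m (curl (W m N ++ m :: gPrefix (m + 1) r)) =
        max (m + 1) (curl (gPrefix (m + 1) r)) := by
      rw [max_eq_right (by omega)]
      refine le_antisymm ?_ (max_le h1 hle)
      by_contra hlt
      rw [not_le, max_lt_iff] at hlt
      have h3 := hasPow_of_long hm hT hE (Nat.succ_le_of_lt hlt.1)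
        ((le_curl_iff (by omega)).1 le_rfl)
      have := (le_curl_iff (by omega)).2 h3
      omega
    rw [h2]
    simp

theorem gPrefix_length_W {m : ℕ} (hm : 2 ≤ m) (hT : InfT m) (N : ℕ) :
    gPrefix m (W m N).length = W m N := by
  induction N with
  | zero => rfl
  | succ N ih =>
    have := gPrefix_chain hm hT ih le_rfl
    rw [W_succ]
    have hg : gPrefix (m + 1) (gl m (N + 1)).length = gl m (N + 1) := by
      rw [gl, T_eq, length_gPrefix]
    rw [hg] at this
    refine Eq.trans (congrArg _ ?_) this
    simp only [List.length_append, List.length_cons]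
    omega

theorem length_W_strictMono (m : ℕ) : StrictMono fun N => (W m N).length :=
  strictMono_nat_of_lt_succ fun N => by simp [W_succ]

/-- The prefixes of `A^(m)` of curling number at most `m` are exactly the strings `W m N`. -/
theorem exists_W_of_curl_le {m k : ℕ} (hm : 2 ≤ m) (hT : InfT m) (hk : curl (gPrefix m k) ≤ m) :
    ∃ N, (W m N).length = k := by
  obtain ⟨N, h1, h2⟩ : ∃ N, (W m N).length ≤ k ∧ k < (W m (N + 1)).length := by
    have hex : ∃ N, k < (W m N).length := ⟨k + 1, (length_W_strictMono m).id_le (k + 1)⟩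
    have h0 : Nat.find hex ≠ 0 := fun h => by
      have := Nat.find_spec hex
      rw [h] at this
      simp [W, chain] at this
    obtain ⟨N, hN⟩ := Nat.exists_eq_succ_of_ne_zero h0
    exact ⟨N, not_lt.1 (Nat.find_min hex (by omega)), by
      have := Nat.find_spec hex
      rwa [hN] at this⟩
  refine ⟨N, ?_⟩
  by_contra hne
  have hlen : (W m (N + 1)).length = (W m N).length + 1 + (gl m (N + 1)).length := by
    rw [W_succ]; simp; omega
  obtain ⟨r, hr⟩ : ∃ r, k = (W m N).length + 1 + r := ⟨k - (W m N).length - 1, by omega⟩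
  have hrlt : r < (gl m (N + 1)).length := by omega
  have e1 := gPrefix_chain hm hT (gPrefix_length_W hm hT N) hrlt.le
  have e2 := gPrefix_chain hm hT (gPrefix_length_W hm hT N) (Nat.succ_le_of_lt hrlt)
  rw [← hr] at e1
  rw [Nat.succ_eq_add_one, ← add_assoc, ← hr, gPrefix, gPrefix, e1, ← List.cons_append,
    ← List.append_assoc] at e2
  have e3 := List.append_cancel_left e2
  rw [← e1, max_eq_left hk] at e3
  have := le_max_left (m + 1) (curl (gPrefix (m + 1) r))
  simp at e3
  omega

theorem infinite_W {m : ℕ} (hm : 1 ≤ m) (hT : InfT m) (hT' : InfT (m + 1)) :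
    {y | curl (W (m + 1) y) ≤ m}.Infinite := by
  refine Set.Infinite.of_image (fun y => (W (m + 1) y).length) (hT.mono ?_)
  intro k hk
  have hk' : curl (gPrefix (m + 1) k) ≤ m := hk
  obtain ⟨y, rfl⟩ := exists_W_of_curl_le (by omega) hT' (hk'.trans (Nat.le_succ m))
  rw [gPrefix_length_W (by omega) hT'] at hk'
  exact ⟨y, hk', rfl⟩

theorem T_eq_W {m : ℕ} (hm : 1 ≤ m) (hT : InfT m) (hT' : InfT (m + 1)) (k : ℕ) :
    T m k = W (m + 1) (Nat.nth (fun y => curl (W (m + 1) y) ≤ m) k) := by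
  have h := Nat.nth_comp_of_strictMono (p := fun k => curl (gPrefix (m + 1) k) ≤ m) (n := k)
    (length_W_strictMono (m + 1))
    (fun k hk => exists_W_of_curl_le (by omega) hT' (le_trans hk (Nat.le_succ m)))
    (fun hfi => absurd hfi hT)
  simp only [gPrefix_length_W (show 2 ≤ m + 1 by omega) hT'] at h
  rw [T_eq, ← h, gPrefix_length_W (by omega) hT']

/-! ### Prefixes of `A^(3)` of small curling number -/

theorem curl_W_three_le_one {s : ℕ} (hs : 1 ≤ s) (hT : InfT 3) : curl (W 3 (4 ^ s + 1)) ≤ 1 := by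
  have hpos : 0 < 4 ^ s := Nat.pow_pos (by omega)
  have h4 : 4 ∣ 4 ^ s := dvd_pow_self 4 (by omega)
  have hg : gl 3 (4 ^ s + 1) = [] := by
    rw [gl_eq (j := 0) (by omega) (by omega) (by simp) (by norm_num; omega), T_zero (by omega)]
  suffices h : curl (W 3 (4 ^ s + 1)) < 2 by omega
  rw [curl_lt_iff le_rfl, W_succ, hg]
  intro hp
  rcases hasPow_cons_cases hp with h | ⟨Z, Y, hn, h⟩
  · simpa using h.le_length
  · obtain ⟨h1, h2, ⟨j, hj, hj', -, hw⟩, P, hP, -, hP'⟩ :=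
      W_pow (by omega) hT (by simp) h hn le_rfl
    set n := Y.count 3
    norm_num at hj hj' hw
    rcases Nat.lt_or_ge 1 n with h1n | h1n
    · by_cases hd : 4 ^ (j + 1) ∣ 4 ^ s
      · obtain ⟨l, hl, hl2, hl3⟩ := hw 1 (by omega) (by omega) (by simpa using hd)
        have := Nat.le_mul_of_pos_left n hl
        omega
      · rw [Nat.pow_dvd_pow_iff_le_right (by omega)] at hd
        have := Nat.le_of_dvd hn ((pow_dvd_pow 4 (show s ≤ j by omega)).trans hj)
        omega
    · have h1n : n = 1 := by omega
      have e1 := hP 1 (by omega) (by omega)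
      have e2 := hP' (by omega)
      rw [h1n] at e1 e2
      rw [gl_eq (j := s) (by omega) (by omega) (by simp)
        (by simpa using not_pow_succ_dvd_pow (b := 4) (j := s) (by omega))] at e1
      rw [gl_eq (j := 0) (by omega) (by omega) (by simp) (by norm_num; omega), T_zero (by omega)]
        at e2
      have e3 : P = [] := by simpa using e2
      rw [e3, List.append_nil, ← T_zero (m := 3) (by omega)] at e1
      have := T_injective hT e1
      omega

theorem curl_W_three_le_two {y : ℕ} (hy : ∀ j, y % 4 ^ (j + 1) < 3 * 4 ^ j) (h1 : y % 4 = 1)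
    (hT : InfT 3) : curl (W 3 y) ≤ 2 := by
  obtain ⟨y, rfl⟩ : ∃ y', y = y' + 1 := ⟨y - 1, by omega⟩
  have hg : gl 3 (y + 1) = [] := by
    rw [gl_eq (j := 0) (by omega) (by omega) (by simp) (by norm_num; omega), T_zero (by omega)]
  suffices h : curl (W 3 (y + 1)) < 3 by omega
  rw [curl_lt_iff (by omega), W_succ, hg]
  intro hp
  rcases hasPow_cons_cases hp with h | ⟨Z, Y, hn, h⟩
  · simpa using h.le_length
  · obtain ⟨h2, j, hj, hw, -⟩ := W_pow_three (by omega) hT (by simp) h hn le_rfl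
    norm_num at hj hw
    have hle := Nat.le_of_dvd hn hj
    refine hw ((y + 1) % 4 ^ (j + 1)) ?_ ((hy j).trans_le (by omega)) (Nat.dvd_sub_mod _)
    rw [Nat.pos_iff_ne_zero]
    intro h0
    have : 4 ∣ y + 1 := (dvd_pow_self 4 (by omega)).trans (Nat.dvd_of_mod_eq_zero h0)
    omega

theorem digits_le_two_step {z d : ℕ} (hd : d ≤ 2) (hz : ∀ j, z % 4 ^ (j + 1) < 3 * 4 ^ j)
    (j : ℕ) : (4 * z + d) % 4 ^ (j + 1) < 3 * 4 ^ j := by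
  rcases j with _ | j
  · norm_num
    omega
  · have h1 := hz j
    have h2 : (4 * z + d) % 4 ^ (j + 1 + 1) = 4 * (z % 4 ^ (j + 1)) + d := by
      rw [pow_succ, mul_comm (4 ^ (j + 1)) 4, Nat.mod_mul]
      have e1 : (4 * z + d) % 4 = d := by omega
      have e2 : (4 * z + d) / 4 = z := by omega
      rw [e1, e2]
      ring
    rw [h2]
    have : 4 ^ (j + 1) = 4 * 4 ^ j := by ring
    omega

theorem digits_le_two_mul {z : ℕ} (hz : ∀ j, z % 4 ^ (j + 1) < 3 * 4 ^ j) (t j : ℕ) :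
    (4 ^ t * z) % 4 ^ (j + 1) < 3 * 4 ^ j := by
  induction t generalizing j with
  | zero => simpa using hz j
  | succ t ih =>
    have := digits_le_two_step (d := 0) (by omega) ih j
    rwa [show 4 * (4 ^ t * z) + 0 = 4 ^ (t + 1) * z by ring] at this

theorem curl_W_three_family {w i : ℕ} (hi : i + 2 ≤ w) (hT : InfT 3) :
    curl (W 3 (10 * 4 ^ w + 4 ^ (i + 1) + 1)) ≤ 2 := by
  have h0 : ∀ j, 0 % 4 ^ (j + 1) < 3 * 4 ^ j := fun j => by
    rw [Nat.zero_mod]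
    positivity
  have h10 := digits_le_two_step (d := 2) le_rfl (digits_le_two_step (d := 2) le_rfl h0)
  obtain ⟨c, rfl⟩ : ∃ c, w = i + 2 + c := ⟨w - (i + 2), by omega⟩
  have h := digits_le_two_step (d := 1) (by omega)
    (digits_le_two_mul (digits_le_two_step (d := 1) (by omega) (digits_le_two_mul h10 c)) i)
  rw [show 10 * 4 ^ (i + 2 + c) + 4 ^ (i + 1) + 1 =
    4 * (4 ^ i * (4 * (4 ^ c * (4 * (4 * 0 + 2) + 2)) + 1)) + 1 by ring]
  exact curl_W_three_le_two h (by omega) hT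

section

variable (hT2 : InfT 2) (hT3 : InfT 3)

include hT2 hT3

theorem exists_curl_T_two_le_one (K : ℕ) : ∃ v, K ≤ v ∧ curl (T 2 v) ≤ 1 := by
  set p := fun y => curl (W 3 y) ≤ 2
  have hinf : {y | p y}.Infinite := infinite_W (m := 2) (by omega) hT2 hT3
  have hTW : ∀ k, T 2 k = W 3 (Nat.nth p k) := T_eq_W (by omega) hT2 hT3
  have hy := curl_W_three_le_one (s := Nat.nth p K + 1) (by omega) hT3
  set y := 4 ^ (Nat.nth p K + 1) + 1 with hydef
  have hpy : p y := by
    change curl (W 3 y) ≤ 2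
    omega
  have hlt : Nat.nth p K + 1 < 4 ^ (Nat.nth p K + 1) := Nat.lt_pow_self (by omega)
  refine ⟨Nat.count p y, ?_, ?_⟩
  · have := Nat.count_nth_of_infinite hinf K
    rw [← this]
    exact Nat.count_monotone _ (show Nat.nth p K ≤ y by omega)
  · rw [hTW, Nat.nth_count hpy]
    exact hy

theorem exists_gap (L : ℕ) : ∃ K, (∀ k, K ≤ k → k < K + L → ¬ curl (T 2 k) ≤ 1) ∧
    ∀ v u, v < K → K ≤ u → curl (T 2 v) ≤ 1 → ∀ P, P <:+ T 2 v → T 2 u ≠ T 2 v ++ P := by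
  set p := fun y => curl (W 3 y) ≤ 2
  have hinf : {y | p y}.Infinite := infinite_W (m := 2) (by omega) hT2 hT3
  obtain ⟨w, hw⟩ : ∃ w, w = L + 2 := ⟨_, rfl⟩
  have hpow : 4 ^ (w + 1) = 4 * 4 ^ w := by ring
  have hwpos : 0 < 4 ^ w := Nat.pow_pos (by omega)
  have hTW : ∀ k, T 2 k = W 3 (Nat.nth p k) := T_eq_W (by omega) hT2 hT3
  have hdig : ∀ y, 2 * 4 ^ (w + 1) ≤ y → y < 4 * 4 ^ (w + 1) → 2 ≤ curl (W 3 y) := by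
    intro y h1 h2
    refine two_le_curl_W (j := w + 1) (by omega) ?_
    norm_num
    rw [Nat.mod_eq_of_lt]
    · exact h1
    · rw [pow_succ 4 (w + 1)]
      omega
  have hdig' : ∀ y, 6 * 4 ^ w ≤ y → y < 8 * 4 ^ w → 2 ≤ curl (W 3 y) := by
    intro y h1 h2
    refine two_le_curl_W (j := w) (by omega) ?_
    norm_num
    have : y % 4 ^ (w + 1) = y - 4 ^ (w + 1) := by
      rw [Nat.mod_eq_sub_mod (by omega), Nat.mod_eq_of_lt (by omega)]
    rw [this]
    omega
  set K := Nat.count p (10 * 4 ^ w) with hK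
  have hge : ∀ k, K ≤ k → 10 * 4 ^ w ≤ Nat.nth p k := fun k hk =>
    (Nat.count_le_iff_le_nth hinf).1 hk
  have hlt : ∀ k, k < K → Nat.nth p k < 10 * 4 ^ w := fun k hk =>
    Nat.nth_lt_of_lt_count hk
  refine ⟨K, ?_, ?_⟩
  · intro k hk hkL hc
    have hfam : ∀ i, i ≤ L → K + i ≤ Nat.count p (10 * 4 ^ w + 4 ^ (i + 1) + 1) := by
      intro i
      induction i with
      | zero => exact fun _ => Nat.count_monotone _ (by omega)
      | succ i ih =>
        intro hi
        have h1 : p (10 * 4 ^ w + 4 ^ (i + 1) + 1) := curl_W_three_family (by omega) hT3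
        have h2 : 4 ^ (i + 1) < 4 ^ (i + 1 + 1) := Nat.pow_lt_pow_right (by omega) (by omega)
        have h3 := Nat.count_strict_mono h1
          (show 10 * 4 ^ w + 4 ^ (i + 1) + 1 < 10 * 4 ^ w + 4 ^ (i + 1 + 1) + 1 by omega)
        have := ih (by omega)
        omega
    have h1 := hfam L le_rfl
    have h2 := Nat.nth_lt_of_lt_count (lt_of_lt_of_le hkL h1)
    have h3 : 4 ^ (L + 1) < 4 ^ w := Nat.pow_lt_pow_right (by omega) (by omega)
    have := hdig _ (by have := hge k hk; omega) (show Nat.nth p k < _ by omega)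
    rw [hTW] at hc
    omega
  · intro v u hv hu hc P hP hTu
    obtain ⟨Z, hZ⟩ := hP
    have hv6 : Nat.nth p v < 6 * 4 ^ w := by
      have := hlt v hv
      rw [hTW] at hc
      by_contra h6
      rcases Nat.lt_or_ge (Nat.nth p v) (8 * 4 ^ w) with h8 | h8
      · have := hdig' _ (by omega) h8
        omega
      · have := hdig _ (by omega) (show Nat.nth p v < _ by omega)
        omega
    have hu10 := hge u hu
    have hcP : Nat.nth p u = Nat.nth p v + P.count 3 := by
      have := congrArg (List.count 3) hTu
      rwa [List.count_append, hTW, hTW, count_W, count_W] at this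
    have hcP' : P.count 3 ≤ Nat.nth p v := by
      have := congrArg (List.count 3) hZ
      rw [List.count_append, hTW, count_W] at this
      omega
    obtain ⟨N, hN⟩ : ∃ N, Nat.nth p u = N + 1 := ⟨Nat.nth p u - 1, by omega⟩
    have hsq : W 3 N ++ 3 :: gl 3 (N + 1) = Z ++ (List.replicate 2 P).flatten := by
      rw [← W_succ, ← hN, ← hTW, hTu, ← hZ]
      simp [List.replicate]
    obtain ⟨-, -, ⟨j, hj, -, hj', -⟩, -⟩ :=
      W_pow (by omega) hT3 (notMem_gl _ _) hsq (by omega) le_rfl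
    norm_num at hj hj'
    rcases Nat.lt_or_ge w j with h | h
    · obtain ⟨c, hc⟩ := (pow_dvd_pow 4 (show w + 1 ≤ j by omega)).trans hj
      rw [hpow] at hc
      have h1 : 1 < c := by
        by_contra h
        have : 4 * 4 ^ w * c ≤ 4 * 4 ^ w * 1 := Nat.mul_le_mul_left _ (by omega)
        omega
      have : 4 * 4 ^ w * 2 ≤ 4 * 4 ^ w * c := Nat.mul_le_mul_left _ h1
      omega
    · have : 4 ^ (j + 1) ≤ 4 ^ (w + 1) := Nat.pow_le_pow_right (by omega) (by omega)
      omega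

end

/-! ### Prefixes of `A^(2)` without square suffixes -/

theorem two_le_curl_W_of_append {m v s : ℕ} {P : List ℕ} (hm : 1 ≤ m)
    (hs : (m + 1) ^ (v + 1) ∣ s) (hs0 : 0 < s) (hP : P <:+ T m v) (hg : gl m s = T m v ++ P) :
    2 ≤ curl (W m (s + (m + 1) ^ v)) := by
  have hn : 0 < (m + 1) ^ v := Nat.pow_pos (by omega)
  have hv : (m + 1) ^ v ∣ s := (pow_dvd_pow _ (by omega)).trans hs
  have hns : (m + 1) ^ (v + 1) ≤ s := Nat.le_of_dvd hs0 hs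
  have hns' : 2 * (m + 1) ^ v ≤ (m + 1) ^ (v + 1) := by
    rw [pow_succ, mul_comm]
    exact Nat.mul_le_mul_left _ (by omega)
  have hnd : ∀ x, (m + 1) ^ (v + 1) ∣ x + (m + 1) ^ v → ¬ (m + 1) ^ (v + 1) ∣ x := fun x h h' =>
    not_pow_succ_dvd_pow (by omega) ((Nat.dvd_add_right h').1 h)
  obtain ⟨s', rfl⟩ : ∃ s', s = s' + (m + 1) ^ v := ⟨s - (m + 1) ^ v, by omega⟩
  have hv' : (m + 1) ^ v ∣ s' := (Nat.dvd_add_left dvd_rfl).1 hv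
  obtain ⟨Z, hZ⟩ := hP
  obtain ⟨r, hr⟩ : ∃ r, s' = r + 1 := ⟨s' - 1, by omega⟩
  have e1 : W m (s' + (m + 1) ^ v + (m + 1) ^ v) =
      W m (s' + (m + 1) ^ v) ++ W m ((m + 1) ^ v) := by
    refine W_add_pow_of_not_dvd hm hv fun h => ?_
    exact hnd _ h hs
  have e2 : W m (s' + (m + 1) ^ v) = W m s' ++ W m ((m + 1) ^ v) ++ P := by
    rw [W_add_pow hm hv', hg, W_pow_eq hm]
    simp
  have e3 : W m s' = W m r ++ m :: Z ++ P := by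
    have := gl_eq (m := m) (x := s') hm (by omega) hv' (hnd _ hs)
    rw [hr] at this ⊢
    rw [W_succ, this, ← hZ]
    simp
  have hne : P ++ W m ((m + 1) ^ v) ≠ [] := by
    rw [W_pow_eq hm]
    simp
  have := two_le_curl_of_square (W m r ++ m :: Z) _ hne
  rw [e1, e2, e3]
  convert this using 2
  simp

theorem curl_W_two_le_one_iff {s v : ℕ} (hT : InfT 2) (hs : 3 ^ (v + 1) ∣ s)
    (hdig : ∀ j, (s + 3 ^ v) % 3 ^ (j + 1) < 2 * 3 ^ j) :
    curl (W 2 (s + 3 ^ v)) ≤ 1 ↔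
      curl (T 2 v) ≤ 1 ∧ (0 < s → ∀ P, P <:+ T 2 v → gl 2 s ≠ T 2 v ++ P) := by
  have hpos : 0 < 3 ^ v := Nat.pow_pos (by omega)
  have hvs : 3 ^ v ∣ s := (pow_dvd_pow 3 (by omega)).trans hs
  have hnd : ¬ 3 ^ (v + 1) ∣ s + 3 ^ v := fun h =>
    not_pow_succ_dvd_pow (b := 3) (by omega) ((Nat.dvd_add_right hs).1 h)
  have hg : gl 2 (s + 3 ^ v) = T 2 v :=
    gl_eq (by omega) (by omega) (dvd_add hvs dvd_rfl) hnd
  obtain ⟨N, hN⟩ : ∃ N, s + 3 ^ v = N + 1 := ⟨s + 3 ^ v - 1, by omega⟩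
  constructor
  · intro h
    refine ⟨le_trans (curl_mono_suffix ?_) h, ?_⟩
    · rw [← hg, hN, W_succ]
      exact (List.suffix_cons _ _).trans (List.suffix_append _ _)
    · intro hs0 P hP hgs
      have := two_le_curl_W_of_append (m := 2) (by omega) hs hs0 hP hgs
      norm_num at this
      omega
  · rintro ⟨hc, hgood⟩
    suffices h : curl (W 2 (s + 3 ^ v)) < 2 by omega
    have hgN := hg
    have hndN := hnd
    rw [hN] at hgN hdig hndN ⊢
    rw [curl_lt_iff le_rfl, W_succ]
    intro hp
    rcases hasPow_cons_cases hp with h | ⟨Z, Y, hn, h⟩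
    · rw [hgN] at h
      have := (le_curl_iff le_rfl).2 h
      omega
    obtain ⟨h1, h2, ⟨j, hj, hj', -, hw⟩, P, hP, hP0, hP'⟩ :=
      W_pow (by omega) hT (notMem_gl _ _) h hn le_rfl
    set n := Y.count 2
    norm_num at hj hj' hw
    have hjn := Nat.le_of_dvd hn hj
    have hP1 := hP 1 (by omega) (by omega)
    rw [one_mul] at hP1
    have hdj := hdig j
    rcases Nat.eq_zero_or_pos ((N + 1) % 3 ^ (j + 1)) with h0 | h0
    · have hd := Nat.dvd_of_mod_eq_zero h0
      have hle := le_of_T_append hT hP1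
      have d1 := (pow_dvd_iff (by omega) (by omega)).1 hd
      have d2 : 3 ^ (j + 1) ∣ N + 1 - n :=
        (pow_dvd_iff (by omega) (by omega)).2 (d1.trans hle)
      apply hj'
      have := Nat.dvd_sub hd d2
      rwa [show N + 1 - (N + 1 - n) = n by omega] at this
    · obtain ⟨l, hl, hl2, hl3⟩ := hw _ h0 (by omega) (Nat.dvd_sub_mod _)
      obtain rfl : l = 1 := by omega
      rw [one_mul] at hl3
      obtain ⟨c, hcn⟩ := hj
      have hn3 : n = 3 ^ j := by
        have : c < 2 := by
          by_contra hc2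
          have : 3 ^ j * 2 ≤ 3 ^ j * c := Nat.mul_le_mul_left _ (by omega)
          omega
        have : c ≠ 0 := by
          rintro rfl
          omega
        obtain rfl : c = 1 := by omega
        omega
      have hsub : 3 ^ (j + 1) ∣ N + 1 - n := by
        rw [← hl3]
        exact Nat.dvd_sub_mod _
      have hxj : 3 ^ j ∣ N + 1 ∧ ¬ 3 ^ (j + 1) ∣ N + 1 := by
        have hx : N + 1 = (N + 1 - n) + 3 ^ j := by omega
        rw [hx]
        exact ⟨dvd_add ((pow_dvd_pow 3 (by omega)).trans hsub) dvd_rfl, fun h =>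
          not_pow_succ_dvd_pow (b := 3) (by omega) ((Nat.dvd_add_right hsub).1 h)⟩
      have hjv : j = v := by
        rw [← (multiplicity_eq_iff (by omega) (by omega)).2 hxj]
        refine (multiplicity_eq_iff (by omega) (by omega)).2 ⟨?_, hndN⟩
        rw [← hN]
        exact dvd_add hvs dvd_rfl
      subst hjv
      have hsn : N + 1 - n = s := by omega
      rw [hsn, hgN] at hP1
      have hs0 : 0 < s := by omega
      refine hgood hs0 P ?_ hP1
      have h3s := Nat.le_of_dvd hs0 hs
      rw [pow_succ] at h3s
      have hP2 := hP' (by omega)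
      rwa [gl_eq (j := j) (by omega) (by omega)] at hP2
      · rw [show N + 1 - 2 * n = s - 3 ^ j by omega]
        exact Nat.dvd_sub hvs dvd_rfl
      · rw [show N + 1 - 2 * n = s - 3 ^ j by omega]
        intro hd
        apply not_pow_succ_dvd_pow (b := 3) (j := j) (by omega)
        have := Nat.dvd_sub hs hd
        rwa [show s - (s - 3 ^ j) = 3 ^ j by omega] at this

/-! ### Reading binary digits in base three -/

theorem chi_two_zero : chi 2 0 = 0 := by simp [chi]

theorem chi_two_step {a d : ℕ} (hd : d < 2) : chi 2 (2 * a + d) = 3 * chi 2 a + d := by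
  rcases Nat.eq_zero_or_pos (2 * a + d) with h | h
  · obtain ⟨rfl, rfl⟩ : a = 0 ∧ d = 0 := by omega
    simp [chi]
  · have h1 : (2 * a + d) % 2 = d := by omega
    have h2 : (2 * a + d) / 2 = a := by omega
    rw [chi, Nat.digits_def' (by omega) h, Nat.ofDigits_cons, h1, h2, chi]
    simp
    ring

theorem ofDigits_two_chi (a : ℕ) : Nat.ofDigits 2 (Nat.digits 3 (chi 2 a)) = a := by
  rw [chi, Nat.digits_ofDigits 3 (by omega), Nat.ofDigits_digits]
  · intro d hd
    exact (Nat.digits_lt_base (by omega) hd).trans (by omega)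
  · intro h
    exact Nat.getLast_digit_ne_zero 2 fun h0 => h (by simp [h0])

theorem two_induction {p : ℕ → Prop} (h0 : p 0) (h : ∀ a d, d < 2 → p a → p (2 * a + d)) (a : ℕ) :
    p a := by
  induction a using Nat.strong_induction_on with
  | _ a ih =>
    rcases Nat.eq_zero_or_pos a with rfl | ha
    · exact h0
    · have := h (a / 2) (a % 2) (Nat.mod_lt _ (by omega)) (ih _ (by omega))
      rwa [Nat.div_add_mod] at this

theorem chi_two_lt {a b : ℕ} (hab : a < b) : chi 2 a < chi 2 b := by
  induction b using two_induction generalizing a with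
  | h0 => omega
  | h b d hd ih =>
    obtain ⟨a, e, he, rfl⟩ : ∃ a' e, e < 2 ∧ a = 2 * a' + e := ⟨a / 2, a % 2, by omega, by omega⟩
    rw [chi_two_step hd, chi_two_step he]
    rcases Nat.lt_or_ge a b with h | h
    · have := ih h
      omega
    · obtain rfl : a = b := by omega
      omega

theorem chi_two_strictMono : StrictMono (chi 2) := fun _ _ => chi_two_lt

theorem chi_two_add_mul {r K : ℕ} (h : ℕ) (hr : r < 2 ^ K) :
    chi 2 (h * 2 ^ K + r) = chi 2 h * 3 ^ K + chi 2 r := by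
  induction K generalizing r with
  | zero =>
    obtain rfl : r = 0 := by omega
    simp [chi_two_zero]
  | succ K ih =>
    obtain ⟨r, d, hd, rfl⟩ : ∃ r' d, d < 2 ∧ r = 2 * r' + d := ⟨r / 2, r % 2, by omega, by omega⟩
    rw [show h * 2 ^ (K + 1) + (2 * r + d) = 2 * (h * 2 ^ K + r) + d by ring, chi_two_step hd,
      chi_two_step hd, ih (by omega)]
    ring

theorem chi_two_pow (v : ℕ) : chi 2 (2 ^ v) = 3 ^ v := by
  have := chi_two_add_mul (r := 0) (K := v) 1 (by positivity)
  have h1 : chi 2 1 = 1 := by simpa [chi_two_zero] using chi_two_step (a := 0) (d := 1) (by omega)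
  simpa [chi_two_zero, h1] using this

theorem chi_two_lt_pow {r K : ℕ} (hr : r < 2 ^ K) : chi 2 r < 3 ^ K := by
  rw [← chi_two_pow]
  exact chi_two_lt hr

theorem chi_two_digits (a j : ℕ) : chi 2 a % 3 ^ (j + 1) < 2 * 3 ^ j := by
  induction a using two_induction generalizing j with
  | h0 =>
    rw [chi_two_zero, Nat.zero_mod]
    positivity
  | h a d hd ih =>
    rw [chi_two_step hd]
    rcases j with _ | j
    · norm_num
      omega
    · have e1 : (3 * chi 2 a + d) % 3 = d := by omega
      have e2 : (3 * chi 2 a + d) / 3 = chi 2 a := by omega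
      have h1 := ih j
      rw [pow_succ, mul_comm (3 ^ (j + 1)) 3, Nat.mod_mul, e1, e2]
      have : 3 ^ (j + 1) = 3 * 3 ^ j := by ring
      omega

theorem exists_chi_two_eq {x : ℕ} (hx : ∀ j, x % 3 ^ (j + 1) < 2 * 3 ^ j) : ∃ a, chi 2 a = x := by
  induction x using Nat.strong_induction_on with
  | _ x ih =>
    rcases Nat.eq_zero_or_pos x with rfl | h0
    · exact ⟨0, chi_two_zero⟩
    · have hd : x % 3 < 2 := by simpa using hx 0
      obtain ⟨a, ha⟩ := ih (x / 3) (by omega) fun j => by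
        have h1 := hx (j + 1)
        rw [pow_succ, mul_comm (3 ^ (j + 1)) 3, Nat.mod_mul] at h1
        have : 3 ^ (j + 1) = 3 * 3 ^ j := by ring
        omega
      exact ⟨2 * a + x % 3, by rw [chi_two_step hd]; omega⟩

theorem exists_add_pow {a : ℕ} (ha : 0 < a) :
    ∃ h v, a = h * 2 ^ (v + 1) + 2 ^ v := by
  obtain ⟨k, m, hm, rfl⟩ := Nat.exists_eq_two_pow_mul_odd ha.ne'
  obtain ⟨h, rfl⟩ := hm
  exact ⟨h, k, by ring⟩

/-! ### The values of `ι_1` -/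

/-- `a` is a value of `ι_1`, that is, `π^(2)(1, χ^(2)(a))` has curling number one. -/
def IotaVal (a : ℕ) : Prop := curl (W 2 (chi 2 a)) ≤ 1

theorem exists_chi_two_eq_of_curl {x : ℕ} (hx : curl (W 2 x) ≤ 1) : ∃ a, chi 2 a = x := by
  refine exists_chi_two_eq fun j => ?_
  by_contra h
  have := two_le_curl_W (m := 2) (j := j) (x := x) (by omega) (by norm_num; omega)
  omega

section

variable (hT1 : InfT 1) (hT2 : InfT 2)

include hT1 hT2

theorem infinite_iotaVal : {a | IotaVal a}.Infinite := by
  refine Set.Infinite.of_image (chi 2) ((infinite_W (m := 1) le_rfl hT1 hT2).mono ?_)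
  intro x hx
  obtain ⟨a, rfl⟩ := exists_chi_two_eq_of_curl hx
  exact ⟨a, hx, rfl⟩

theorem iota_one (n : ℕ) : iota 1 (n + 1) = Nat.nth IotaVal n := by
  have h := Nat.nth_comp_of_strictMono (p := fun y => curl (W 2 y) ≤ 1) (n := n)
    chi_two_strictMono (fun k hk => exists_chi_two_eq_of_curl hk)
    (fun hfi => absurd hfi (infinite_W (m := 1) le_rfl hT1 hT2))
  change Nat.ofDigits 2 (Nat.digits 3 ((T 1 n).count 2)) = _
  rw [T_eq_W le_rfl hT1 hT2, count_W]
  change Nat.ofDigits 2 (Nat.digits 3 (Nat.nth (fun y => curl (W 2 y) ≤ 1) n)) = _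
  rw [← h, ofDigits_two_chi]
  rfl

end

theorem iotaVal_iff {h v : ℕ} (hT : InfT 2) : IotaVal (h * 2 ^ (v + 1) + 2 ^ v) ↔
    curl (T 2 v) ≤ 1 ∧
      (0 < h → ∀ P, P <:+ T 2 v → gl 2 (chi 2 h * 3 ^ (v + 1)) ≠ T 2 v ++ P) := by
  have hlt : 2 ^ v < 2 ^ (v + 1) := Nat.pow_lt_pow_right (by omega) (by omega)
  have e : chi 2 (h * 2 ^ (v + 1) + 2 ^ v) = chi 2 h * 3 ^ (v + 1) + 3 ^ v := by
    rw [chi_two_add_mul _ hlt, chi_two_pow]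
  rw [IotaVal, e, curl_W_two_le_one_iff hT (Dvd.intro_left _ rfl)
    (fun j => by rw [← e]; exact chi_two_digits _ j)]
  have : 0 < chi 2 h * 3 ^ (v + 1) ↔ 0 < h := by
    rw [Nat.mul_pos_iff_of_pos_right (by positivity)]
    conv_lhs => rw [← chi_two_zero]
    exact chi_two_strictMono.lt_iff_lt
  rw [this]

theorem exists_gl_eq {m x : ℕ} {K : ℕ} (hm : 1 ≤ m) (hx : 0 < x) (h : (m + 1) ^ K ∣ x) :
    ∃ u, K ≤ u ∧ gl m x = T m u :=
  ⟨_, (pow_dvd_iff (by omega) hx).1 h, rfl⟩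

theorem chi_two_pos {h : ℕ} (hh : 0 < h) : 0 < chi 2 h := by
  rw [← chi_two_zero]
  exact chi_two_lt hh

theorem iotaVal_add_iff {K h r : ℕ} (hT : InfT 2)
    (hK : ∀ v u, v < K → K ≤ u → curl (T 2 v) ≤ 1 → ∀ P, P <:+ T 2 v → T 2 u ≠ T 2 v ++ P)
    (hr0 : 0 < r) (hr : r < 2 ^ K) : IotaVal (h * 2 ^ K + r) ↔ IotaVal r := by
  obtain ⟨h', v, rfl⟩ := exists_add_pow hr0
  have hvK : v < K := (Nat.pow_lt_pow_iff_right (a := 2) (by omega)).1 (by omega)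
  obtain ⟨c, rfl⟩ : ∃ c, K = v + 1 + c := ⟨K - (v + 1), by omega⟩
  have hc : h' < 2 ^ c := by
    rw [pow_add 2 (v + 1) c, mul_comm h'] at hr
    exact lt_of_mul_lt_mul_left (lt_of_le_of_lt (Nat.le_add_right _ _) hr) (Nat.zero_le _)
  rw [show h * 2 ^ (v + 1 + c) + (h' * 2 ^ (v + 1) + 2 ^ v) =
    (h * 2 ^ c + h') * 2 ^ (v + 1) + 2 ^ v by ring, iotaVal_iff hT, iotaVal_iff hT]
  refine and_congr_right fun hcv => ?_
  rw [chi_two_add_mul _ hc]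
  rcases Nat.eq_zero_or_pos h' with rfl | h0
  · simp only [lt_irrefl, false_imp_iff, iff_true, add_zero, chi_two_zero]
    intro hpos P hP
    have hh : 0 < chi 2 h := chi_two_pos (Nat.pos_of_mul_pos_right hpos)
    obtain ⟨u, hu, hg⟩ := exists_gl_eq (m := 2) (x := chi 2 h * 3 ^ c * 3 ^ (v + 1))
      (K := v + 1 + c) (by omega) (by positivity) ⟨chi 2 h, by ring⟩
    rw [hg]
    exact hK v u hvK hu hcv P hP
  · have hg : gl 2 ((chi 2 h * 3 ^ c + chi 2 h') * 3 ^ (v + 1)) =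
        gl 2 (chi 2 h' * 3 ^ (v + 1)) := by
      rw [show (chi 2 h * 3 ^ c + chi 2 h') * 3 ^ (v + 1) =
        chi 2 h * 3 ^ (v + 1 + c) + chi 2 h' * 3 ^ (v + 1) by ring]
      refine gl_add (j := v + 1 + c) (by omega) (Dvd.intro_left _ rfl) ?_ ?_
      · have := chi_two_pos h0
        positivity
      · calc chi 2 h' * 3 ^ (v + 1) < 3 ^ c * 3 ^ (v + 1) :=
            Nat.mul_lt_mul_of_pos_right (chi_two_lt_pow hc) (by positivity)
          _ = 3 ^ (v + 1 + c) := by ring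
    rw [hg]
    simp [h0]

theorem pow_dvd_of_iotaVal_mul {K L h : ℕ} (hT : InfT 2)
    (hK : ∀ k, K ≤ k → k < K + L → ¬ curl (T 2 k) ≤ 1) (hval : IotaVal (h * 2 ^ K)) :
    2 ^ (K + L) ∣ h * 2 ^ K := by
  rcases Nat.eq_zero_or_pos h with rfl | h0
  · simp
  obtain ⟨h', w, rfl⟩ := exists_add_pow h0
  have e : (h' * 2 ^ (w + 1) + 2 ^ w) * 2 ^ K = h' * 2 ^ (K + w + 1) + 2 ^ (K + w) := by ring
  rw [e, iotaVal_iff hT] at hval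
  have hL : L ≤ w := by
    by_contra hLw
    exact hK (K + w) (by omega) (by omega) hval.1
  rw [e]
  exact dvd_add ((pow_dvd_pow 2 (by omega)).trans (Dvd.intro_left _ rfl))
    (pow_dvd_pow 2 (by omega))

theorem iotaVal_two_pow_add {h v v' : ℕ} (hT : InfT 2) (hvv : v < v')
    (hv : curl (T 2 v) ≤ 1) (hv' : curl (T 2 v') ≤ 1) :
    IotaVal (h * 2 ^ (v' + 1) + (2 ^ v' + 2 ^ v)) := by
  obtain ⟨c, rfl⟩ : ∃ c, v' = v + 1 + c := ⟨v' - (v + 1), by omega⟩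
  rw [show h * 2 ^ (v + 1 + c + 1) + (2 ^ (v + 1 + c) + 2 ^ v) =
    (h * 2 ^ (c + 1) + 2 ^ c) * 2 ^ (v + 1) + 2 ^ v by ring, iotaVal_iff hT]
  refine ⟨hv, fun _ P hP hg => ?_⟩
  rw [chi_two_add_mul _ (Nat.pow_lt_pow_right (by omega) (by omega)), chi_two_pow,
    show (chi 2 h * 3 ^ (c + 1) + 3 ^ c) * 3 ^ (v + 1) =
      chi 2 h * 3 ^ (v + 1 + c + 1) + 3 ^ (v + 1 + c) by ring,
    gl_eq (j := v + 1 + c) (by omega) (by positivity)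
      (dvd_add ((pow_dvd_pow 3 (by omega)).trans (Dvd.intro_left _ rfl)) dvd_rfl)
      (fun h => not_pow_succ_dvd_pow (b := 3) (by omega)
        ((Nat.dvd_add_right (Dvd.intro_left _ rfl)).1 h))] at hg
  by_cases hP0 : P = []
  · rw [hP0, List.append_nil] at hg
    have := T_injective hT hg
    omega
  · obtain ⟨Z, hZ⟩ := hP
    have := two_le_curl_of_square Z P hP0
    rw [hZ, ← hg] at this
    omega

/-! ### Counting -/

theorem count_mul_of_periodic {q : ℕ → Prop} [DecidablePred q] {N : ℕ}
    (hq : Function.Periodic q N) (k : ℕ) : Nat.count q (k * N) = k * Nat.count q N := by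
  induction k with
  | zero => simp
  | succ k ih =>
    have h : (fun i => q (k * N + i)) = q := by
      funext i
      rw [add_comm]
      exact hq.nat_mul k i
    rw [add_mul, one_mul, Nat.count_add, ih]
    simp only [h]
    ring

theorem count_le_of_periodic {q : ℕ → Prop} [DecidablePred q] {N : ℕ} (hN : 0 < N)
    (hq : Function.Periodic q N) (M : ℕ) :
    (Nat.count q M : ℝ) ≤ M * (Nat.count q N / N) + Nat.count q N := by
  have h1 : M ≤ (M / N + 1) * N := by
    have := Nat.lt_div_mul_add (a := M) hN
    rw [add_mul]
    omega
  have h2 : Nat.count q M ≤ (M / N + 1) * Nat.count q N :=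
    (Nat.count_monotone q h1).trans_eq (count_mul_of_periodic hq _)
  have h3 : ((M / N : ℕ) : ℝ) ≤ M / N := Nat.cast_div_le
  have h4 : (Nat.count q M : ℝ) ≤ ((M / N : ℕ) + 1) * Nat.count q N := by exact_mod_cast h2
  calc (Nat.count q M : ℝ) ≤ ((M / N : ℕ) + 1) * Nat.count q N := h4
    _ ≤ (M / N + 1) * Nat.count q N := by gcongr
    _ = _ := by ring

theorem le_count_of_periodic {q : ℕ → Prop} [DecidablePred q] {N : ℕ} (hN : 0 < N)
    (hq : Function.Periodic q N) (M : ℕ) :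
    M * ((Nat.count q N : ℝ) / N) ≤ Nat.count q M + Nat.count q N := by
  have h2 : M / N * Nat.count q N ≤ Nat.count q M :=
    (count_mul_of_periodic hq _).symm.trans_le (Nat.count_monotone q (Nat.div_mul_le_self M N))
  have h3 : (M : ℝ) / N ≤ (M / N : ℕ) + 1 := by
    rw [div_le_iff₀ (by exact_mod_cast hN)]
    have := Nat.lt_div_mul_add (a := M) hN
    have : M ≤ (M / N + 1) * N := by
      rw [add_mul]
      omega
    exact_mod_cast this
  have h4 : ((M / N : ℕ) : ℝ) * Nat.count q N ≤ Nat.count q M := by exact_mod_cast h2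
  calc M * ((Nat.count q N : ℝ) / N) = M / N * Nat.count q N := by ring
    _ ≤ ((M / N : ℕ) + 1) * Nat.count q N := by gcongr
    _ ≤ _ := by linarith

theorem count_eq_one {q : ℕ → Prop} [DecidablePred q] {N a : ℕ} (ha : a < N)
    (hq : ∀ i < N, q i ↔ i = a) : Nat.count q N = 1 := by
  rw [Nat.count_eq_card_filter_range, Finset.card_eq_one]
  refine ⟨a, ?_⟩
  ext i
  simp only [Finset.mem_filter, Finset.mem_range, Finset.mem_singleton]
  exact ⟨fun h => (hq i h.1).1 h.2, by rintro rfl; exact ⟨ha, (hq _ ha).2 rfl⟩⟩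

theorem count_le_count_add {p q r : ℕ → Prop} [DecidablePred p] [DecidablePred q]
    [DecidablePred r] (h : ∀ a, p a → q a ∨ r a) (M : ℕ) :
    Nat.count p M ≤ Nat.count q M + Nat.count r M := by
  simp only [Nat.count_eq_card_filter_range]
  refine (Finset.card_le_card fun a ha => ?_).trans (Finset.card_union_le _ _)
  simp only [Finset.mem_union, Finset.mem_filter] at ha ⊢
  exact (h a ha.2).imp (fun h => ⟨ha.1, h⟩) fun h => ⟨ha.1, h⟩

theorem count_add_le_count {p q r : ℕ → Prop} [DecidablePred p] [DecidablePred q]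
    [DecidablePred r] (hq : ∀ a, q a → p a) (hr : ∀ a, r a → p a) (hqr : ∀ a, q a → ¬ r a)
    (M : ℕ) : Nat.count q M + Nat.count r M ≤ Nat.count p M := by
  simp only [Nat.count_eq_card_filter_range]
  rw [← Finset.card_union_of_disjoint]
  · refine Finset.card_le_card fun a ha => ?_
    simp only [Finset.mem_union, Finset.mem_filter] at ha ⊢
    exact ha.elim (fun h => ⟨h.1, hq a h.2⟩) fun h => ⟨h.1, hr a h.2⟩
  · rw [Finset.disjoint_filter]
    exact fun a _ => hqr a

section

variable {D : ℕ → Prop} {ν : ℝ} (hD : {a | D a}.Infinite)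
  (hν : Tendsto (fun n : ℕ => ((n + 1 : ℕ) : ℝ) / Nat.nth D n) atTop (nhds ν))

include hD

theorem eventually_nth_pos : ∀ᶠ n : ℕ in atTop, (0 : ℝ) < Nat.nth D n := by
  filter_upwards [eventually_gt_atTop 0] with n hn
  exact_mod_cast (Nat.zero_le _).trans_lt (Nat.nth_strictMono hD hn)

include hν

theorem tendsto_add_div_nth (C : ℝ) :
    Tendsto (fun n : ℕ => ((n : ℝ) + C) / Nat.nth D n) atTop (nhds ν) := by
  have h1 : Tendsto (fun n : ℕ => (Nat.nth D n : ℝ)) atTop atTop :=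
    tendsto_natCast_atTop_atTop.comp (Nat.nth_strictMono hD).tendsto_atTop
  have h2 := hν.add (h1.const_div_atTop (C - 1))
  rw [add_zero] at h2
  refine h2.congr fun n => ?_
  push_cast
  ring

theorem density_le [DecidablePred D] {α C : ℝ} (h : ∀ M : ℕ, (Nat.count D M : ℝ) ≤ M * α + C) :
    ν ≤ α := by
  refine le_of_tendsto (tendsto_add_div_nth hD hν (-C)) ?_
  filter_upwards [eventually_nth_pos hD] with n hn
  rw [div_le_iff₀ hn]
  have := h (Nat.nth D n)
  rw [Nat.count_nth_of_infinite hD] at this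
  linarith

theorem le_density [DecidablePred D] {α C : ℝ} (h : ∀ M : ℕ, M * α ≤ (Nat.count D M : ℝ) + C) :
    α ≤ ν := by
  refine ge_of_tendsto (tendsto_add_div_nth hD hν C) ?_
  filter_upwards [eventually_nth_pos hD] with n hn
  rw [le_div_iff₀ hn]
  have := h (Nat.nth D n)
  rw [Nat.count_nth_of_infinite hD] at this
  linarith

end

/-! ### Irrationality of `ν_1` -/

theorem mul_two_pow_div_add_mod (a K : ℕ) : a / 2 ^ K * 2 ^ K + a % 2 ^ K = a := by
  rw [mul_comm]
  exact Nat.div_add_mod _ _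

theorem exists_close {ν : ℝ} (hT1 : InfT 1) (hT2 : InfT 2) (hT3 : InfT 3)
    (hν : Tendsto (fun n : ℕ => ((n + 1 : ℕ) : ℝ) / Nat.nth IotaVal n) atTop (nhds ν)) (L : ℕ) :
    ∃ p K : ℕ, 0 < 2 ^ K * ν - p ∧ 2 ^ K * ν - p ≤ 1 / 2 ^ L := by
  obtain ⟨K, hgap, hsuf⟩ := exists_gap hT2 hT3 L
  obtain ⟨v, hKv, hv⟩ := exists_curl_T_two_le_one hT2 hT3 K
  obtain ⟨v', hvv, hv'⟩ := exists_curl_T_two_le_one hT2 hT3 (v + 1)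
  have hD := infinite_iotaVal hT1 hT2
  let q₁ : ℕ → Prop := fun a => IotaVal (a % 2 ^ K) ∧ a % 2 ^ K ≠ 0
  let q₂ : ℕ → Prop := fun a => 2 ^ (K + L) ∣ a
  let q₃ : ℕ → Prop := fun a => a % 2 ^ (v' + 1) = 2 ^ v' + 2 ^ v
  have hp₁ : Function.Periodic q₁ (2 ^ K) := fun a => by simp [q₁]
  have hp₂ : Function.Periodic q₂ (2 ^ (K + L)) := fun a => by simp [q₂]
  have hp₃ : Function.Periodic q₃ (2 ^ (v' + 1)) := fun a => by simp [q₃]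
  have hc₂ : Nat.count q₂ (2 ^ (K + L)) = 1 :=
    count_eq_one (a := 0) (by positivity) fun i hi =>
      ⟨fun h => Nat.eq_zero_of_dvd_of_lt h hi, by rintro rfl; exact dvd_zero _⟩
  have hlt : 2 ^ v' + 2 ^ v < 2 ^ (v' + 1) := by
    have : 2 ^ v < 2 ^ v' := Nat.pow_lt_pow_right (by omega) (by omega)
    rw [pow_succ]
    omega
  have hc₃ : Nat.count q₃ (2 ^ (v' + 1)) = 1 :=
    count_eq_one hlt fun i hi => by simp only [q₃, Nat.mod_eq_of_lt hi]
  have hval : ∀ a, a % 2 ^ K ≠ 0 → (IotaVal a ↔ IotaVal (a % 2 ^ K)) := fun a ha => by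
    have := iotaVal_add_iff (h := a / 2 ^ K) hT2 hsuf (Nat.pos_of_ne_zero ha)
      (Nat.mod_lt a (by positivity))
    rwa [mul_two_pow_div_add_mod] at this
  have hup : ∀ a, IotaVal a → q₁ a ∨ q₂ a := fun a ha => by
    by_cases h0 : a % 2 ^ K = 0
    · right
      have e := mul_two_pow_div_add_mod a K
      rw [h0, add_zero] at e
      have := pow_dvd_of_iotaVal_mul (h := a / 2 ^ K) hT2 hgap (by rwa [e])
      rwa [e] at this
    · exact Or.inl ⟨(hval a h0).1 ha, h0⟩
  have h1 : ∀ a, q₁ a → IotaVal a := fun a ha => (hval a ha.2).2 ha.1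
  have h3 : ∀ a, q₃ a → IotaVal a := fun a ha => by
    have ha' : a % 2 ^ (v' + 1) = 2 ^ v' + 2 ^ v := ha
    rw [← mul_two_pow_div_add_mod a (v' + 1), ha']
    exact iotaVal_two_pow_add hT2 hvv hv hv'
  have h13 : ∀ a, q₁ a → ¬ q₃ a := fun a ha ha3 => by
    have ha' : a % 2 ^ (v' + 1) = 2 ^ v' + 2 ^ v := ha3
    refine ha.2 (Nat.mod_eq_zero_of_dvd ?_)
    rw [← mul_two_pow_div_add_mod a (v' + 1), ha']
    exact dvd_add (Dvd.dvd.mul_left (pow_dvd_pow 2 (by omega)) _)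
      (dvd_add (pow_dvd_pow 2 (by omega)) (pow_dvd_pow 2 (by omega)))
  set p := Nat.count q₁ (2 ^ K)
  have hle : ν ≤ p / 2 ^ K + 1 / 2 ^ (K + L) := by
    refine density_le (C := p + 1) hD hν fun M => ?_
    have e1 := count_le_of_periodic (by positivity) hp₁ M
    have e2 := count_le_of_periodic (by positivity) hp₂ M
    have e3 : (Nat.count IotaVal M : ℝ) ≤ Nat.count q₁ M + Nat.count q₂ M := by
      exact_mod_cast count_le_count_add hup M
    rw [hc₂] at e2
    push_cast at e1 e2
    linarith
  have hge : p / 2 ^ K + 1 / 2 ^ (v' + 1) ≤ ν := by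
    refine le_density (C := p + 1) hD hν fun M => ?_
    have e1 := le_count_of_periodic (by positivity) hp₁ M
    have e2 := le_count_of_periodic (by positivity) hp₃ M
    have e3 : (Nat.count q₁ M : ℝ) + Nat.count q₃ M ≤ Nat.count IotaVal M := by
      exact_mod_cast count_add_le_count h1 h3 h13 M
    rw [hc₃] at e2
    push_cast at e1 e2
    linarith
  refine ⟨p, K, ?_, ?_⟩
  · have : (p : ℝ) / 2 ^ K < ν := lt_of_lt_of_le (lt_add_of_pos_right _ (by positivity)) hge
    rw [div_lt_iff₀ (by positivity)] at this
    linarith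
  · have : 2 ^ K * ν ≤ 2 ^ K * (p / 2 ^ K + 1 / 2 ^ (K + L)) := by gcongr
    have e : (2 : ℝ) ^ K * (p / 2 ^ K + 1 / 2 ^ (K + L)) = p + 1 / 2 ^ L := by
      rw [pow_add]
      field_simp
    linarith

theorem irrational_of_close {ν : ℝ}
    (h : ∀ L : ℕ, ∃ p K : ℕ, 0 < 2 ^ K * ν - p ∧ 2 ^ K * ν - p ≤ 1 / 2 ^ L) : Irrational ν := by
  rintro ⟨r, rfl⟩
  obtain ⟨p, K, h0, h1⟩ := h r.den
  have hden : (0 : ℝ) < r.den := by exact_mod_cast r.den_pos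
  have hr : (r : ℝ) * r.den = r.num := by exact_mod_cast Rat.mul_den_eq_num r
  have e : ((2 : ℝ) ^ K * r - p) * r.den = ((2 ^ K * r.num - p * r.den : ℤ) : ℝ) := by
    push_cast
    rw [← hr]
    ring
  have hpos : (0 : ℝ) < ((2 ^ K * r.num - p * r.den : ℤ) : ℝ) := e ▸ mul_pos h0 hden
  have hone : (1 : ℝ) ≤ ((2 ^ K * r.num - p * r.den : ℤ) : ℝ) := by
    have : (0 : ℤ) < 2 ^ K * r.num - p * r.den := by exact_mod_cast hpos
    exact_mod_cast Int.add_one_le_of_lt this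
  have hlt : (r.den : ℝ) < 2 ^ r.den := by exact_mod_cast Nat.lt_two_pow_self
  have : (1 : ℝ) / 2 ^ r.den * r.den < 1 := by
    rw [one_div, inv_mul_lt_iff₀ (by positivity), mul_one]
    exact hlt
  have := mul_le_mul_of_nonneg_right h1 hden.le
  linarith

theorem infinite_approx_of_irrational {ν : ℝ} (h : Irrational ν) {κ : ℝ} (hκ : κ < 2) :
    {pq : ℤ × ℤ | 0 < pq.2 ∧ 0 < |ν - (pq.1 : ℝ) / (pq.2 : ℝ)| ∧
      |ν - (pq.1 : ℝ) / (pq.2 : ℝ)| < 1 / (pq.2 : ℝ) ^ κ}.Infinite := by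
  have hinj : Function.Injective fun q : ℚ => (q.num, (q.den : ℤ)) := fun a b hab => by
    simp only [Prod.mk.injEq, Nat.cast_inj] at hab
    exact Rat.ext hab.1 hab.2
  refine ((Real.infinite_rat_abs_sub_lt_one_div_den_sq_of_irrational h).image
    hinj.injOn).mono ?_
  rintro _ ⟨q, hq, rfl⟩
  have hq' : |ν - q| < 1 / (q.den : ℝ) ^ 2 := hq
  have hcast : ((q.num : ℤ) : ℝ) / ((q.den : ℤ) : ℝ) = q := by
    rw [Int.cast_natCast]
    exact (Rat.cast_def q).symm
  have hden : (1 : ℝ) ≤ q.den := by exact_mod_cast q.den_pos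
  refine ⟨Int.natCast_pos.2 q.den_pos, ?_, ?_⟩
  · rw [hcast]
    exact abs_pos.2 (sub_ne_zero.2 (h.ne_rat q))
  · rw [hcast]
    refine hq'.trans_le ?_
    rw [Int.cast_natCast, ← Real.rpow_two]
    exact one_div_le_one_div_of_le (Real.rpow_pos_of_pos (by linarith) _)
      (Real.rpow_le_rpow_of_exponent_le hden hκ.le)

end Gijswijt

/-- Theorem `nu1 irrational`. `ν_1` is irrational and has irrationality
measure at least `2`: for every real `κ < 2` there are infinitely many `(p,q)`, `q > 0`,
with `0 < |ν_1 − p/q| < 1/q^κ`. -/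
theorem statement13 (hSH : StandingHyp) (ν : ℝ)
    (hν : Tendsto (fun x : ℕ => (x : ℝ) / (iota 1 x : ℝ)) atTop (nhds ν)) :
    Irrational ν ∧
    ∀ κ : ℝ, κ < 2 →
      {pq : ℤ × ℤ | 0 < pq.2 ∧ 0 < |ν - (pq.1 : ℝ) / (pq.2 : ℝ)| ∧
        |ν - (pq.1 : ℝ) / (pq.2 : ℝ)| < 1 / (pq.2 : ℝ) ^ κ}.Infinite := by
  have hT1 : Gijswijt.InfT 1 := (hSH 1 (by omega)).2
  have hT2 : Gijswijt.InfT 2 := (hSH 2 (by omega)).2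
  have hT3 : Gijswijt.InfT 3 := (hSH 3 (by omega)).2
  have hirr : Irrational ν := by
    refine Gijswijt.irrational_of_close (Gijswijt.exists_close hT1 hT2 hT3 ?_)
    refine (hν.comp (tendsto_add_atTop_nat 1)).congr fun n => ?_
    simp only [Function.comp_apply]
    rw [Gijswijt.iota_one hT1 hT2]
  exact ⟨hirr, fun κ hκ => Gijswijt.infinite_approx_of_irrational hirr hκ⟩
end

section
/- For every integer m ≥ 1 there exists a real number ε_m with 0 < ε_m < 20 such that β^(m)(t)/(m+1)^{t−1} → ε_m as t → ∞, i.e., β^(m)(t) ~ ε_m·(m+1)^{t−1}. -/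
open List Filter

open scoped Classical

/-- `IsRep g n k l`: the word `g 0, …, g (n - 1)` ends in the `k`-th power of a word of length `l`. -/
def IsRep (g : ℕ → ℕ) (n k l : ℕ) : Prop :=
  0 < l ∧ k * l ≤ n ∧ ∀ i, n ≤ i + k * l → i + l < n → g i = g (i + l)

/-- The terms of `A^(m)`, indexed from `0`. -/
noncomputable def letter (m n : ℕ) : ℕ := max m (curl (gPrefix m n))

theorem gPrefix_eq_map (m n : ℕ) : gPrefix m n = (List.range n).map (letter m) := by
  induction n with
  | zero => rfl
  | succ n ih => rw [List.range_succ, List.map_append, ← ih]; rfl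

theorem le_curl_iff {S : List ℕ} {k : ℕ} (hk : 2 ≤ k) :
    k ≤ curl S ↔ ∃ X Y : List ℕ, Y ≠ [] ∧ S = X ++ (List.replicate k Y).flatten := by
  set s := {k | ∃ X Y : List ℕ, Y ≠ [] ∧ S = X ++ (List.replicate k Y).flatten} with hs
  have hb : BddAbove s := by
    refine ⟨S.length, ?_⟩
    rintro j ⟨X, Y, hY, h⟩
    have h1 : 1 ≤ Y.length := List.length_pos_of_ne_nil hY
    have h2 : S.length = X.length + j * Y.length := by rw [h]; simp
    nlinarith
  have hne : s.Nonempty := ⟨0, S, [0], by simp, by simp⟩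
  change k ≤ max 1 (sSup s) ↔ k ∈ s
  constructor
  · intro h
    have h' : k ≤ sSup s := by omega
    obtain ⟨X, Y, hY, hS⟩ := Nat.sSup_mem hne hb
    refine ⟨X ++ (List.replicate (sSup s - k) Y).flatten, Y, hY, ?_⟩
    rw [List.append_assoc, ← List.flatten_append, List.replicate_append_replicate,
      Nat.sub_add_cancel h']
    exact hS
  · intro h
    exact le_max_of_le_right (le_csSup hb h)

theorem map_range_eq_flatten_replicate (g : ℕ → ℕ) (l k s : ℕ)
    (h : ∀ i, s ≤ i → i + l < s + k * l → g i = g (i + l)) :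
    (List.range (k * l)).map (fun j => g (s + j)) =
      (List.replicate k ((List.range l).map fun j => g (s + j))).flatten := by
  induction k generalizing s with
  | zero => simp
  | succ k ih =>
    have e : (k + 1) * l = l + k * l := by ring
    rw [e, List.range_add, List.map_append, List.map_map, List.replicate_succ, List.flatten_cons]
    congr 1
    have := ih (s + l) (fun i h1 h2 => h i (by omega) (by rw [e]; omega))
    rw [show (fun j => g (s + j)) ∘ (fun x => l + x) = fun j => g (s + l + j) by
      funext j; simp [add_assoc], this]
    rcases Nat.eq_zero_or_pos k with rfl | hk
    · simp
    congr 2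
    apply List.map_congr_left
    intro j hj
    have hj := List.mem_range.1 hj
    rw [h (s + j) (by omega) (by rw [e]; nlinarith)]
    congr 1; ring

theorem le_curl_map_range_iff {g : ℕ → ℕ} {n k : ℕ} (hk : 2 ≤ k) :
    k ≤ curl ((List.range n).map g) ↔ ∃ l, IsRep g n k l := by
  rw [le_curl_iff hk]
  constructor
  · rintro ⟨X, Y, hY, h⟩
    obtain ⟨k, rfl⟩ : ∃ j, k = j + 1 := ⟨k - 1, by omega⟩
    have hn : n = X.length + (k + 1) * Y.length := by simpa using congrArg List.length h
    have e : (k + 1) * Y.length = Y.length + k * Y.length := by ring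
    refine ⟨Y.length, List.length_pos_of_ne_nil hY, by omega, fun i h1 h2 => ?_⟩
    have key (j : ℕ) (hj : j < n) :
        (X ++ (List.replicate (k + 1) Y).flatten)[j]? = some (g j) := by
      rw [← h]; simp [hj]
    have a1 := key i (by omega)
    have a2 := key (i + Y.length) h2
    rw [List.replicate_succ', List.flatten_append, List.getElem?_append_right (by omega),
      List.getElem?_append_left (by simp; omega)] at a1
    rw [List.replicate_succ, List.flatten_cons, List.getElem?_append_right (by omega),
      List.getElem?_append_right (by omega),
      show i + Y.length - X.length - Y.length = i - X.length by omega, a1] at a2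
    exact Option.some.inj a2
  · rintro ⟨l, hl, hkl, h⟩
    refine ⟨(List.range (n - k * l)).map g, (List.range l).map fun j => g (n - k * l + j),
      ?_, ?_⟩
    · simpa using hl.ne'
    · rw [← map_range_eq_flatten_replicate g l k (n - k * l)
        (fun i h1 h2 => h i (by omega) (by omega))]
      conv_lhs => rw [show n = (n - k * l) + k * l by omega, List.range_add, List.map_append,
        List.map_map]
      rfl

theorem le_curl_gPrefix_iff {m n k : ℕ} (hk : 2 ≤ k) :
    k ≤ curl (gPrefix m n) ↔ ∃ l, IsRep (letter m) n k l := by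
  rw [gPrefix_eq_map, le_curl_map_range_iff hk]

theorem letter_eq_iff {m n : ℕ} : letter m n = m ↔ curl (gPrefix m n) ≤ m := by
  simp [letter]

theorem le_letter (m n : ℕ) : m ≤ letter m n := le_max_left _ _

section count

variable {g : ℕ → ℕ} {m n k l : ℕ}

theorem IsRep.count_shift (h : IsRep g n k l) {i : ℕ} (h1 : n ≤ i + k * l) (h2 : i + l ≤ n) :
    Nat.count (g · = m) (i + l) + Nat.count (g · = m) (n - l) =
      Nat.count (g · = m) i + Nat.count (g · = m) n := by
  obtain ⟨d, hd⟩ : ∃ d, i + l + d = n := ⟨n - (i + l), by omega⟩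
  induction d generalizing i with
  | zero =>
    rw [show n - l = i by omega, show i + l = n by omega, add_comm]
  | succ d ih =>
    have := ih (i := i + 1) (by omega) (by omega) (by omega)
    rw [show i + 1 + l = i + l + 1 by omega, Nat.count_succ, Nat.count_succ,
      ← h.2.2 i h1 (by omega)] at this
    omega

/-- The number of occurrences of `m` in one period. -/
def periodCount (g : ℕ → ℕ) (m n l : ℕ) : ℕ :=
  Nat.count (g · = m) n - Nat.count (g · = m) (n - l)

theorem IsRep.count_sub (h : IsRep g n k l) {j : ℕ} (hj : j ≤ k) :
    Nat.count (g · = m) (n - j * l) + j * periodCount g m n l = Nat.count (g · = m) n := by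
  have hm : Nat.count (g · = m) (n - l) ≤ Nat.count (g · = m) n := Nat.count_monotone _ (by omega)
  induction j with
  | zero => simp
  | succ j ih =>
    have ih := ih (by omega)
    have e : (j + 1) * l = j * l + l := by ring
    have e2 : (j + 1) * l ≤ k * l := Nat.mul_le_mul_right _ hj
    have h2 := h.2.1
    have := h.count_shift (m := m) (i := n - (j + 1) * l) (by omega) (by omega)
    rw [show n - (j + 1) * l + l = n - j * l by omega] at this
    have e3 : (j + 1) * periodCount g m n l = j * periodCount g m n l + periodCount g m n l := by
      ring
    rw [e3]
    unfold periodCount at *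
    omega

theorem IsRep.mul_periodCount_le (h : IsRep g n k l) :
    k * periodCount g m n l ≤ Nat.count (g · = m) n := by
  have := h.count_sub (m := m) le_rfl
  omega

theorem IsRep.nth_add (h : IsRep g n k l) (hk : 1 ≤ k) (hinf : {i | g i = m}.Infinite) {e : ℕ}
    (h1 : Nat.count (g · = m) n ≤ e + k * periodCount g m n l)
    (h2 : e + periodCount g m n l < Nat.count (g · = m) n) :
    n ≤ Nat.nth (g · = m) e + k * l ∧ Nat.nth (g · = m) e + l < n ∧
      Nat.nth (g · = m) e + l = Nat.nth (g · = m) (e + periodCount g m n l) := by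
  have hl := h.2.1
  have hkl : l ≤ k * l := Nat.le_mul_of_pos_left _ hk
  have a1 := h.count_sub (m := m) le_rfl
  have a2 := h.count_sub (m := m) hk
  rw [one_mul, one_mul] at a2
  have b1 : n - k * l ≤ Nat.nth (g · = m) e := by
    by_contra hc
    have := Nat.count_monotone (g · = m) (show Nat.nth (g · = m) e + 1 ≤ n - k * l by omega)
    rw [Nat.count_succ, Nat.count_nth_of_infinite hinf,
      if_pos (Nat.nth_mem_of_infinite hinf e)] at this
    omega
  have b2 : Nat.nth (g · = m) e < n - l := Nat.nth_lt_of_lt_count (by omega)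
  refine ⟨by omega, by omega, ?_⟩
  have c1 := h.count_shift (m := m) (i := Nat.nth (g · = m) e) (by omega) (by omega)
  rw [Nat.count_nth_of_infinite hinf] at c1
  have c2 : g (Nat.nth (g · = m) e + l) = m := by
    rw [← h.2.2 _ (by omega) (by omega)]
    exact Nat.nth_mem_of_infinite hinf e
  rw [← Nat.nth_count (p := (g · = m)) c2]
  congr 1
  omega

end count

/-- The largest `k` with `b ^ k ∣ c`. -/
noncomputable def val (b c : ℕ) : ℕ := multiplicity b c

/-- The lengths of the prefixes of `A^(m+1)` of curling number at most `m`, indexed from `0`. -/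
noncomputable def cut (m v : ℕ) : ℕ := tau m (v + 1)

theorem pow_dvd_iff_le_val {b c k : ℕ} (hb : 2 ≤ b) (hc : 0 < c) : b ^ k ∣ c ↔ k ≤ val b c :=
  FiniteMultiplicity.pow_dvd_iff_le_multiplicity
    (Nat.finiteMultiplicity_iff.2 ⟨by omega, hc⟩)

theorem val_pow {b w : ℕ} (hb : 2 ≤ b) : val b (b ^ w) = w := by
  have hp : 0 < b ^ w := by positivity
  apply le_antisymm
  · exact (Nat.pow_dvd_pow_iff_le_right (by omega)).1 ((pow_dvd_iff_le_val hb hp).2 le_rfl)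
  · exact (pow_dvd_iff_le_val hb hp).1 dvd_rfl

theorem pow_val_le {b c : ℕ} (hb : 2 ≤ b) (hc : 0 < c) : b ^ val b c ≤ c :=
  Nat.le_of_dvd hc ((pow_dvd_iff_le_val hb hc).2 le_rfl)

theorem pow_val_succ_not_dvd {b c : ℕ} (hb : 2 ≤ b) (hc : 0 < c) : ¬ b ^ (val b c + 1) ∣ c := by
  rw [pow_dvd_iff_le_val hb hc]; omega

section levels

variable {m : ℕ}

theorem piLen_eq (m x : ℕ) : piLen m x = Nat.nth (letter m · = m) x := by
  simp only [piLen, letter_eq_iff]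

theorem StandingHyp.letter_infinite (hSH : StandingHyp) (hm : 1 ≤ m) :
    {i | letter m i = m}.Infinite := by
  simpa only [letter_eq_iff] using (hSH m hm).1

theorem StandingHyp.piLen_strictMono (hSH : StandingHyp) (hm : 1 ≤ m) : StrictMono (piLen m) :=
  Nat.nth_strictMono (hSH m hm).1

theorem StandingHyp.letter_piLen (hSH : StandingHyp) (hm : 1 ≤ m) (e : ℕ) :
    letter m (piLen m e) = m :=
  letter_eq_iff.2 (Nat.nth_mem_of_infinite (hSH m hm).1 e)

theorem exists_piLen_eq {n : ℕ} (h : letter m n = m) : ∃ e, piLen m e = n :=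
  ⟨_, Nat.nth_count (p := fun k => curl (gPrefix m k) ≤ m) (letter_eq_iff.1 h)⟩

theorem curl_nil : curl [] = 1 := by
  by_contra h
  have h1 : 1 ≤ curl [] := le_max_left _ _
  obtain ⟨X, Y, hY, h⟩ := (le_curl_iff (S := []) le_rfl).1 (show 2 ≤ curl [] by omega)
  simp [List.replicate, hY] at h

theorem piLen_zero (hm : 1 ≤ m) : piLen m 0 = 0 := by
  unfold piLen
  exact Nat.nth_zero_of_zero (p := fun k => curl (gPrefix m k) ≤ m) (by simpa [gPrefix, curl_nil])

theorem cut_zero (hm : 1 ≤ m) : cut m 0 = 0 := by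
  unfold cut tau
  exact Nat.nth_zero_of_zero (p := fun k => curl (gPrefix (m + 1) k) ≤ m)
    (by simpa [gPrefix, curl_nil])

theorem StandingHyp.cut_strictMono (hSH : StandingHyp) (hm : 1 ≤ m) : StrictMono (cut m) :=
  Nat.nth_strictMono (hSH m hm).2

theorem StandingHyp.curl_cut (hSH : StandingHyp) (hm : 1 ≤ m) (v : ℕ) :
    curl (gPrefix (m + 1) (cut m v)) ≤ m :=
  Nat.nth_mem_of_infinite (hSH m hm).2 v

theorem exists_cut_eq {n : ℕ} (h : curl (gPrefix (m + 1) n) ≤ m) : ∃ v, cut m v = n :=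
  ⟨_, Nat.nth_count (p := fun k => curl (gPrefix (m + 1) k) ≤ m) h⟩

theorem letter_succ_ne (m s : ℕ) : letter (m + 1) s ≠ m := by
  have := le_letter (m + 1) s
  omega

theorem StandingHyp.exists_piLen_le (hSH : StandingHyp) (hm : 1 ≤ m) (r : ℕ) :
    ∃ j, piLen m j ≤ r ∧ r < piLen m (j + 1) := by
  have hmono := hSH.piLen_strictMono hm
  induction r with
  | zero => exact ⟨0, by rw [piLen_zero hm], by have := hmono (show 0 < 0 + 1 by omega); omega⟩
  | succ r ih =>
    obtain ⟨j, h1, h2⟩ := ih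
    by_cases h : r + 1 < piLen m (j + 1)
    · exact ⟨j, by omega, h⟩
    · exact ⟨j + 1, by omega, by have := hmono (show j + 1 < j + 1 + 1 by omega); omega⟩

/-- The first `n` terms of `A^(m)` have the shape prescribed by the structure theorem, where
the first `c + 1` occurrences of `m` are taken into account. -/
structure IsGlued (m c n : ℕ) : Prop where
  gap : ∀ e < c, piLen m (e + 1) = piLen m e + 1 + cut m (val (m + 1) (e + 1))
  glue : ∀ e s, s < cut m (val (m + 1) (e + 1)) → piLen m e + 1 + s < n →
    letter m (piLen m e + 1 + s) = letter (m + 1) s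

theorem val_add_of_lt {b w z j : ℕ} (hb : 2 ≤ b) (hz : b ^ w ∣ z) (h0 : 0 < j) (hj : j < b ^ w) :
    val b (z + j) = val b j := by
  have hlt (i : ℕ) (h : b ^ i ∣ j) : i ≤ w :=
    ((Nat.pow_lt_pow_iff_right (by omega : 1 < b)).1
      (lt_of_le_of_lt (Nat.le_of_dvd h0 h) hj)).le
  apply le_antisymm
  · rw [← pow_dvd_iff_le_val hb h0]
    have h1 := (pow_dvd_iff_le_val hb (show 0 < z + j by omega)).2 le_rfl
    rcases le_total (val b (z + j)) w with h | h
    · exact (Nat.dvd_add_right ((pow_dvd_pow b h).trans hz)).1 h1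
    · have := (Nat.dvd_add_right hz).1 ((pow_dvd_pow b h).trans h1)
      exact absurd (Nat.le_of_dvd h0 this) (by omega)
  · rw [← pow_dvd_iff_le_val hb (by omega)]
    have h1 := (pow_dvd_iff_le_val hb h0).2 le_rfl
    exact dvd_add ((pow_dvd_pow b (hlt _ h1)).trans hz) h1

theorem val_le_val_add {b w z j : ℕ} (hb : 2 ≤ b) (hz : b ^ w ∣ z) (h0 : 0 < j)
    (hj : j ≤ b ^ w) : val b j ≤ val b (z + j) := by
  rw [← pow_dvd_iff_le_val hb (by omega)]
  have h1 := (pow_dvd_iff_le_val hb h0).2 le_rfl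
  have : val b j ≤ w :=
    (Nat.pow_le_pow_iff_right (by omega : 1 < b)).1 ((Nat.le_of_dvd h0 h1).trans hj)
  exact dvd_add ((pow_dvd_pow b this).trans hz) h1

theorem IsGlued.piLen_add {c n w z j : ℕ} (h : IsGlued m c n) (hm : 1 ≤ m)
    (hz : (m + 1) ^ w ∣ z) (hj : j < (m + 1) ^ w) (hc : z + j ≤ c) :
    piLen m (z + j) = piLen m z + piLen m j := by
  induction j with
  | zero => simp [piLen_zero hm]
  | succ j ih =>
    rw [← add_assoc, h.gap _ (by omega), h.gap j (by omega), ih (by omega) (by omega), add_assoc z,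
      val_add_of_lt (by omega) hz (by omega) hj]
    ring

theorem IsGlued.letter_add {c n w z r : ℕ} (h : IsGlued m c n) (hSH : StandingHyp) (hm : 1 ≤ m)
    (hz : (m + 1) ^ w ∣ z) (hr : r < piLen m ((m + 1) ^ w)) (hw : (m + 1) ^ w ≤ c)
    (hc : z + (m + 1) ^ w ≤ c + 1) (hn : piLen m z + r < n) :
    letter m (piLen m z + r) = letter m r := by
  obtain ⟨j, h1, h2⟩ := hSH.exists_piLen_le hm r
  have hmono := hSH.piLen_strictMono hm
  have hj : j < (m + 1) ^ w := hmono.lt_iff_lt.1 (by omega)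
  have hadd := h.piLen_add hm hz hj (by omega)
  obtain ⟨s, rfl⟩ : ∃ s, r = piLen m j + s := ⟨r - piLen m j, by omega⟩
  rw [← add_assoc, ← hadd]
  rcases s with _ | s
  · simp [hSH.letter_piLen hm]
  · rw [h.gap j (by omega)] at h2
    have hv := val_le_val_add (by omega : 2 ≤ m + 1) hz (show 0 < j + 1 by omega) hj
    have := (hSH.cut_strictMono hm).monotone hv
    rw [add_comm s, ← add_assoc, ← add_assoc, h.glue j s (by omega) (by omega),
      h.glue (z + j) s (by rw [add_assoc z]; omega) (by omega)]

theorem IsGlued.isRep {c n w : ℕ} (h : IsGlued m c n) (hSH : StandingHyp) (hm : 1 ≤ m)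
    (hw : (m + 1) ^ (w + 1) ∣ c + 1) (hn : n = piLen m c + 1 + cut m w) :
    IsRep (letter m) n (m + 1) (piLen m ((m + 1) ^ w)) := by
  set y := (m + 1) ^ w with hy
  set l := piLen m y with hl
  have hy0 : 0 < y := by positivity
  have hdvd : y ∣ c + 1 := (pow_dvd_pow _ (by omega)).trans hw
  rw [pow_succ, ← hy] at hw
  have hle : y * (m + 1) ≤ c + 1 := Nat.le_of_dvd (by omega) hw
  have hy2 : 2 * y ≤ c + 1 := by nlinarith
  have hly : l = piLen m (y - 1) + 1 + cut m w := by
    have := h.gap (y - 1) (by omega)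
    rw [Nat.sub_add_cancel hy0, hy, val_pow (by omega)] at this
    exact this
  have hdvdj (j : ℕ) : y ∣ c + 1 - j * y := Nat.dvd_sub hdvd ⟨j, by ring⟩
  have hpos (j : ℕ) (h1 : 1 ≤ j) (h2 : j ≤ m + 1) : piLen m (c + 1 - j * y) + j * l = n := by
    induction j, h1 using Nat.le_induction with
    | base =>
      have := h.piLen_add (w := w) (z := c + 1 - y) (j := y - 1) hm (by rw [← one_mul y]; exact hdvdj 1)
        (by omega) (by omega)
      rw [show c + 1 - y + (y - 1) = c by omega] at this
      rw [one_mul, one_mul]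
      omega
    | succ j hj ih =>
      have ih := ih (by omega)
      have e : (j + 1) * y = j * y + y := by ring
      have e2 : (j + 1) * y ≤ (m + 1) * y := Nat.mul_le_mul_right _ h2
      have e3 : (m + 1) * y = y * (m + 1) := by ring
      have e4 : y ≤ j * y := Nat.le_mul_of_pos_left _ hj
      have h3 := h.piLen_add (w := w) (z := c + 1 - (j + 1) * y) (j := y - 1) hm (hdvdj _)
        (by omega) (by omega)
      have h4 := h.gap (c + 1 - (j + 1) * y + (y - 1)) (by omega)
      rw [show c + 1 - (j + 1) * y + (y - 1) + 1 = c + 1 - j * y by omega] at h4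
      have hv : val (m + 1) (c + 1 - j * y) = w := by
        apply le_antisymm
        · by_contra hc
          have h5 := (pow_dvd_iff_le_val (by omega : 2 ≤ m + 1)
            (show 0 < c + 1 - j * y by omega)).2 (show w + 1 ≤ _ by omega)
          rw [pow_succ, ← hy] at h5
          have h6 := Nat.dvd_sub hw h5
          rw [show c + 1 - (c + 1 - j * y) = y * j by rw [mul_comm y]; omega] at h6
          have := Nat.le_of_dvd hj (Nat.dvd_of_mul_dvd_mul_left hy0 h6)
          omega
        · exact (pow_dvd_iff_le_val (by omega) (by omega)).1 (hdvdj j)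
      rw [hv] at h4
      have e5 : (j + 1) * l = j * l + l := by ring
      omega
  have hl0 : 0 < l := by omega
  have key (i : ℕ) (h1 : n ≤ i + (m + 1) * l) (h2 : i < n) :
      letter m i = letter m (l - 1 - (n - 1 - i) % l) := by
    have hj : (n - 1 - i) / l < m + 1 := by
      rw [Nat.div_lt_iff_lt_mul hl0]; omega
    have hd := Nat.div_add_mod (n - 1 - i) l
    have hmod := Nat.mod_lt (n - 1 - i) hl0
    generalize (n - 1 - i) / l = j at hj hd
    have hp := hpos (j + 1) (by omega) (by omega)
    have e : (j + 1) * l = l * j + l := by ring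
    have hle' : (j + 1) * y ≤ y * (m + 1) := by
      rw [mul_comm y]; exact Nat.mul_le_mul_right _ hj
    have e4 : (j + 1) * y = j * y + y := by ring
    have := h.letter_add (w := w) (z := c + 1 - (j + 1) * y) (r := l - 1 - (n - 1 - i) % l)
      hSH hm (hdvdj _) (by rw [← hy]; omega) (by omega) (by omega) (by omega)
    rw [← this]
    congr 1
    omega
  refine ⟨hl0, by have := hpos (m + 1) (by omega) le_rfl; omega, fun i h1 h2 => ?_⟩
  rw [key i h1 (by omega), key (i + l) (by omega) h2,
    show n - 1 - i = n - 1 - (i + l) + l by omega, Nat.add_mod_right]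

theorem StandingHyp.count_eq (hSH : StandingHyp) (hm : 1 ≤ m) {c n : ℕ} (h1 : piLen m c < n)
    (h2 : n ≤ piLen m (c + 1)) : Nat.count (letter m · = m) n = c + 1 := by
  have hinf := hSH.letter_infinite hm
  have a1 := Nat.count_monotone (letter m · = m) (show piLen m c + 1 ≤ n from h1)
  have a2 := Nat.count_monotone (letter m · = m) h2
  rw [Nat.count_succ, if_pos (hSH.letter_piLen hm c)] at a1
  rw [piLen_eq, Nat.count_nth_of_infinite hinf] at a1 a2
  omega

end levels

/-- The divisibility constraints that a period imposes on the valuations. -/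
theorem eq_two_of_val_periodic {b x y : ℕ} (hb : 2 ≤ b) (hy : 0 < y) (hxy : b * y ≤ x)
    (hv : val b x ≤ val b y)
    (h : ∀ c, x < c + b * y → c + y < x → val b c = val b (c + y)) :
    b = 2 ∧ 2 * y < x ∧ val b y < val b (x - y) := by
  have hx : 0 < x := by nlinarith
  set w := val b y with hw
  have hndx : ¬ b ^ (w + 1) ∣ x := by rw [pow_dvd_iff_le_val hb hx]; omega
  have hndy : ¬ b ^ (w + 1) ∣ y := pow_val_succ_not_dvd hb hy
  have hMle : b ^ (w + 1) ≤ b * y := by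
    rw [pow_succ, mul_comm]; exact Nat.mul_le_mul_left _ (pow_val_le hb hy)
  have hR0 : 0 < x % b ^ (w + 1) := Nat.pos_of_ne_zero fun h0 => hndx (Nat.dvd_of_mod_eq_zero h0)
  have hRlt : x % b ^ (w + 1) < b ^ (w + 1) := Nat.mod_lt _ (by positivity)
  have hdvd : b ^ (w + 1) ∣ x - x % b ^ (w + 1) := Nat.dvd_sub_mod x
  set c := x - x % b ^ (w + 1) with hc
  have hvc : w + 1 ≤ val b c := (pow_dvd_iff_le_val hb (by omega)).1 hdvd
  have h1 : x ≤ c + y := by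
    by_contra hlt
    have := h c (by omega) (by omega)
    rw [this] at hvc
    exact hndy ((Nat.dvd_add_right hdvd).1 ((pow_dvd_iff_le_val hb (by omega)).2 hvc))
  have h2 : c + b * y ≤ x + y := by
    by_contra hlt
    have hyy : 2 * y ≤ b * y := Nat.mul_le_mul_right _ hb
    have hyc : y < c := by
      by_contra hle
      have : b * y ≤ 2 * y := by omega
      have hc0 : c < x := by omega
      have hby : x = 2 * y := by omega
      have hcy : c = y := by omega
      rw [hcy] at hdvd
      exact hndy hdvd
    have := h (c - y) (by omega) (by omega)
    rw [Nat.sub_add_cancel hyc.le] at this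
    rw [← this] at hvc
    have h5 := Nat.dvd_sub hdvd ((pow_dvd_iff_le_val hb (by omega)).2 hvc)
    rw [show c - (c - y) = y by omega] at h5
    exact hndy h5
  have hb2 : b = 2 := by
    have : b * y ≤ 2 * y := by omega
    have := Nat.le_of_mul_le_mul_right this hy
    omega
  subst hb2
  have hcxy : c = x - y := by omega
  refine ⟨rfl, ?_, by rw [← hcxy]; omega⟩
  rcases hxy.lt_or_eq with h3 | h3
  · exact h3
  · exact absurd (h3 ▸ show 2 ^ (w + 1) ∣ 2 * y by
      rw [pow_succ, mul_comm]; exact Nat.mul_dvd_mul_left _ ((pow_dvd_iff_le_val hb hy).2 le_rfl)) hndx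

section structureTheorem

variable {m : ℕ}

/-- The hypotheses on a prefix of `A^(m)` ending `q` letters into the glue word that follows the
`(c + 1)`-st occurrence of `m`. -/
structure IsGluedAt (m c q : ℕ) : Prop extends IsGlued m c (piLen m c + 1 + q) where
  le_cut : q ≤ cut m (val (m + 1) (c + 1))

namespace IsGluedAt

variable {c q : ℕ}

theorem letter_eq (h : IsGluedAt m c q) {s : ℕ} (hs : s < q) :
    letter m (piLen m c + 1 + s) = letter (m + 1) s :=
  h.glue c s (hs.trans_le h.le_cut) (by omega)

theorem le_piLen_succ (h : IsGluedAt m c q) (hSH : StandingHyp) (hm : 1 ≤ m) :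
    piLen m c + 1 + q ≤ piLen m (c + 1) := by
  by_contra hlt
  have h1 := hSH.piLen_strictMono hm (show c < c + 1 by omega)
  have h2 := h.letter_eq (s := piLen m (c + 1) - (piLen m c + 1)) (by omega)
  rw [show piLen m c + 1 + (piLen m (c + 1) - (piLen m c + 1)) = piLen m (c + 1) by omega,
    hSH.letter_piLen hm] at h2
  exact letter_succ_ne _ _ h2.symm

theorem count (h : IsGluedAt m c q) (hSH : StandingHyp) (hm : 1 ≤ m) :
    Nat.count (letter m · = m) (piLen m c + 1 + q) = c + 1 :=
  hSH.count_eq hm (by omega) (h.le_piLen_succ hSH hm)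

theorem piLen_add_le (h : IsGluedAt m c q) (hSH : StandingHyp) (hm : 1 ≤ m) {l : ℕ}
    (hy : 0 < periodCount (letter m) m (piLen m c + 1 + q) l) :
    piLen m c + 1 + q ≤ piLen m c + l := by
  by_contra hlt
  have h1 := Nat.count_monotone (letter m · = m)
    (show piLen m c + 1 ≤ piLen m c + 1 + q - l by omega)
  rw [hSH.count_eq hm (Nat.lt_succ_self _) (hSH.piLen_strictMono hm (Nat.lt_succ_self c))] at h1
  unfold periodCount at hy
  rw [h.count hSH hm] at hy
  omega

theorem isRep_iff (h : IsGluedAt m c q) (hSH : StandingHyp) (hm : 1 ≤ m) {k l : ℕ}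
    (hy : periodCount (letter m) m (piLen m c + 1 + q) l = 0) :
    IsRep (letter m) (piLen m c + 1 + q) k l → IsRep (letter (m + 1)) q k l := by
  intro hr
  have h1 := hr.count_sub (m := m) le_rfl
  rw [hy, h.count hSH hm] at h1
  have h2 : k * l ≤ q := by
    by_contra hlt
    have h3 := Nat.count_monotone (letter m · = m)
      (show piLen m c + 1 + q - k * l ≤ piLen m c by omega)
    have h4 : Nat.count (letter m · = m) (piLen m c) = c := by
      rw [piLen_eq, Nat.count_nth_of_infinite (hSH.letter_infinite hm)]
    omega
  refine ⟨hr.1, h2, fun i h3 h4 => ?_⟩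
  rw [← h.letter_eq (by omega), ← h.letter_eq h4, hr.2.2 _ (by omega) (by omega),
    add_assoc (piLen m c + 1)]

theorem isRep_of_isRep (h : IsGluedAt m c q) {k l : ℕ} (hr : IsRep (letter (m + 1)) q k l) :
    IsRep (letter m) (piLen m c + 1 + q) k l := by
  have := hr.2.1
  refine ⟨hr.1, by omega, fun i h1 h2 => ?_⟩
  obtain ⟨s, rfl⟩ : ∃ s, i = piLen m c + 1 + s := ⟨i - (piLen m c + 1), by omega⟩
  rw [add_assoc (piLen m c + 1), h.letter_eq (by omega), h.letter_eq (by omega)]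
  exact hr.2.2 s (by omega) (by omega)

theorem le_of_isRep (h : IsGluedAt m c q) (hSH : StandingHyp) (hm : 1 ≤ m) {k l : ℕ}
    (hr : IsRep (letter m) (piLen m c + 1 + q) k l)
    (hy : 0 < periodCount (letter m) m (piLen m c + 1 + q) l) : k ≤ m + 1 := by
  by_contra hk
  obtain ⟨j, rfl⟩ : ∃ j, k = j + 1 := ⟨k - 1, by omega⟩
  have h1 := h.piLen_add_le hSH hm hy
  have h2 := hr.2.1
  have e : (j + 1) * l = j * l + l := by ring
  have h3 : j ≤ curl (gPrefix m (piLen m c)) := (le_curl_gPrefix_iff (by omega)).2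
    ⟨l, hr.1, by nlinarith [h.piLen_add_le hSH hm hy, hr.mul_periodCount_le (m := m)],
      fun i a1 a2 => hr.2.2 i (by omega) (by omega)⟩
  have h4 := letter_eq_iff.1 (hSH.letter_piLen hm c)
  omega

theorem le_curl_iff (h : IsGluedAt m c q) (hSH : StandingHyp) (hm : 1 ≤ m) {k : ℕ}
    (hk : m + 2 ≤ k) :
    k ≤ curl (gPrefix m (piLen m c + 1 + q)) ↔ k ≤ curl (gPrefix (m + 1) q) := by
  rw [le_curl_gPrefix_iff (by omega), le_curl_gPrefix_iff (by omega)]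
  refine exists_congr fun l => ⟨fun hr => ?_, h.isRep_of_isRep⟩
  refine h.isRep_iff hSH hm ?_ hr
  by_contra hy
  have := h.le_of_isRep hSH hm hr (by omega)
  omega

theorem periodCount_eq_zero (h : IsGluedAt m c q) (hSH : StandingHyp) (hm : 1 ≤ m) {l : ℕ}
    (hq : q = cut m (val (m + 1) (c + 1)))
    (hr : IsRep (letter m) (piLen m c + 1 + q) (m + 1) l) :
    periodCount (letter m) m (piLen m c + 1 + q) l = 0 := by
  by_contra hy0
  have hy : 0 < periodCount (letter m) m (piLen m c + 1 + q) l := by omega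
  have hcount := h.count hSH hm
  have hmul := hr.mul_periodCount_le (m := m)
  have hnl := h.piLen_add_le hSH hm hy
  have hshift (e : ℕ) := hr.nth_add (m := m) (by omega) (hSH.letter_infinite hm) (e := e)
  simp only [← piLen_eq, hcount] at hshift hmul
  set n := piLen m c + 1 + q with hn
  set y := periodCount (letter m) m n l with hydef
  have hmono := hSH.piLen_strictMono hm
  have hcut := hSH.cut_strictMono hm
  have hb : 2 ≤ m + 1 := by omega
  have hyy : 2 * y ≤ (m + 1) * y := Nat.mul_le_mul_right _ hb
  have hgap : q ≤ cut m (val (m + 1) (c + 1 - y)) := by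
    by_contra hlt
    obtain ⟨e, he⟩ : ∃ e, c = e + y := ⟨c - y, by omega⟩
    obtain ⟨a1, a2, a3⟩ := hshift e (by omega) (by omega)
    rw [← he] at a3
    have a4 := h.gap e (by omega)
    rw [show c + 1 - y = e + 1 by omega] at hlt
    have a5 := hr.2.2 (piLen m (e + 1)) (by omega) (by omega)
    rw [hSH.letter_piLen hm, show piLen m (e + 1) + l =
      piLen m c + 1 + cut m (val (m + 1) (e + 1)) by omega, h.letter_eq (by omega)] at a5
    exact letter_succ_ne _ _ a5.symm
  rw [hq, hcut.le_iff_le] at hgap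
  have hxV := (pow_dvd_iff_le_val hb (show 0 < c + 1 by omega)).2 le_rfl
  have hxyV := (pow_dvd_iff_le_val hb (show 0 < c + 1 - y by omega)).2 hgap
  have hyV : (m + 1) ^ val (m + 1) (c + 1) ∣ y := by
    have := Nat.dvd_sub hxV hxyV
    rwa [show c + 1 - (c + 1 - y) = y by omega] at this
  have hvy := (pow_dvd_iff_le_val hb hy).1 hyV
  obtain ⟨hm2, h2y, hvxy⟩ := eq_two_of_val_periodic hb hy hmul hvy (fun d h1 h2 => by
    obtain ⟨e, rfl⟩ : ∃ e, d = e + 1 := by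
      refine ⟨d - 1, ?_⟩
      rcases d with _ | d
      · omega
      · rfl
    obtain ⟨-, -, a1⟩ := hshift e (by omega) (by omega)
    obtain ⟨-, -, a2⟩ := hshift (e + 1) (by omega) (by omega)
    have a3 := h.gap e (by omega)
    have a4 := h.gap (e + y) (by omega)
    rw [show e + 1 + y = e + y + 1 by omega] at a2 ⊢
    exact hcut.injective (by omega))
  obtain rfl : m = 1 := by omega
  simp only [show 1 + 1 = 2 from rfl] at *
  obtain ⟨f, hf⟩ : ∃ f, c = f + 2 * y := ⟨c - 2 * y, by omega⟩
  rw [show c + 1 - y = f + y + 1 by omega] at hgap hvxy hxyV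
  have hvf : val 2 (f + 1) = val 2 (c + 1) := by
    apply le_antisymm
    · by_contra hlt
      have a1 := (pow_dvd_iff_le_val hb (show 0 < f + 1 by omega)).2
        (show val 2 (c + 1) + 1 ≤ _ by omega)
      have a2 : 2 ^ (val 2 (c + 1) + 1) ∣ 2 * y := by
        rw [pow_succ, mul_comm]; exact Nat.mul_dvd_mul_left _ hyV
      have a3 := dvd_add a1 a2
      rw [show f + 1 + 2 * y = c + 1 by omega] at a3
      exact pow_val_succ_not_dvd le_rfl (by omega) a3
    · rw [← pow_dvd_iff_le_val le_rfl (by omega)]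
      have := Nat.dvd_sub hxV (hyV.mul_left 2)
      rwa [show c + 1 - 2 * y = f + 1 by omega] at this
  have g1 : piLen 1 (f + 1) = piLen 1 f + 1 + cut 1 (val 2 (f + 1)) := h.gap f (by omega)
  have g2 : piLen 1 (f + y + 1) = piLen 1 (f + y) + 1 + cut 1 (val 2 (f + y + 1)) :=
    h.gap (f + y) (by omega)
  obtain ⟨-, -, s1⟩ := hshift (f + y) (by omega) (by omega)
  obtain ⟨-, -, s2⟩ := hshift (f + 1) (by omega) (by omega)
  rw [show f + y + y = c by omega] at s1
  rw [show f + 1 + y = f + y + 1 by omega] at s2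
  rw [hvf, ← hq] at g1
  have hlt : q < cut 1 (val 2 (f + y + 1)) := by rw [hq]; exact hcut (by omega)
  obtain ⟨z, hz⟩ : ∃ z, cut 1 (val 2 (f + y + 1)) = q + z := ⟨_, (Nat.add_sub_cancel' hlt.le).symm⟩
  have hle : piLen 1 (f + y + 1) ≤ piLen 1 c := hmono.monotone (by omega)
  have hzq : z ≤ q := by
    by_contra hlt'
    have b1 := hr.2.2 (piLen 1 f) (by omega) (by omega)
    rw [hSH.letter_piLen le_rfl, show piLen 1 f + l = piLen 1 (f + y) + 1 + (z - 1) by omega,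
      h.glue (f + y) (z - 1) (by simp only [show 1 + 1 = 2 from rfl]; omega) (by omega)] at b1
    exact letter_succ_ne _ _ b1.symm
  have hrep : IsRep (letter 2) (cut 1 (val 2 (f + y + 1))) 2 z := by
    refine ⟨by omega, by omega, fun i h1 h2 => ?_⟩
    rw [← h.glue f i (by simp only [show 1 + 1 = 2 from rfl]; rw [hvf]; omega) (by omega),
      ← h.glue (f + y) (i + z) h2 (by omega), hr.2.2 _ (by omega) (by omega)]
    congr 1
    omega
  have := (le_curl_gPrefix_iff (m := 2) le_rfl).2 ⟨z, hrep⟩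
  have := hSH.curl_cut le_rfl (val 2 (f + y + 1))
  simp only [show 1 + 1 = 2 from rfl] at this
  omega

theorem letter_of_lt (h : IsGluedAt m c q) (hSH : StandingHyp) (hm : 1 ≤ m)
    (hq : q < cut m (val (m + 1) (c + 1))) :
    letter m (piLen m c + 1 + q) = letter (m + 1) q := by
  have h1 : m + 1 ≤ curl (gPrefix m (piLen m c + 1 + q)) := by
    by_cases hc : m + 1 ≤ curl (gPrefix (m + 1) q)
    · obtain ⟨l, hl⟩ := (le_curl_gPrefix_iff (by omega)).1 hc
      exact (le_curl_gPrefix_iff (by omega)).2 ⟨l, h.isRep_of_isRep hl⟩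
    · obtain ⟨w, rfl⟩ := exists_cut_eq (m := m) (n := q) (by omega)
      have hw := (hSH.cut_strictMono hm).lt_iff_lt.1 hq
      exact (le_curl_gPrefix_iff (by omega)).2 ⟨_, h.isRep hSH hm
        ((pow_dvd_iff_le_val (by omega) (by omega)).2 hw) rfl⟩
  apply le_antisymm
  · unfold letter
    rcases h1.lt_or_eq with h2 | h2
    · have := (h.le_curl_iff hSH hm (k := curl (gPrefix m (piLen m c + 1 + q))) (by omega)).1 le_rfl
      omega
    · omega
  · unfold letter
    by_cases h2 : m + 2 ≤ curl (gPrefix (m + 1) q)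
    · have := (h.le_curl_iff hSH hm h2).2 le_rfl
      omega
    · omega

theorem letter_of_eq (h : IsGluedAt m c q) (hSH : StandingHyp) (hm : 1 ≤ m)
    (hq : q = cut m (val (m + 1) (c + 1))) : letter m (piLen m c + 1 + q) = m := by
  rw [letter_eq_iff]
  by_contra hlt
  obtain ⟨l, hl⟩ := (le_curl_gPrefix_iff (m := m) (n := piLen m c + 1 + q) (k := m + 1)
    (by omega)).1 (by omega)
  have := (le_curl_gPrefix_iff (m := m + 1) (n := q) (k := m + 1) (by omega)).2
    ⟨l, h.isRep_iff hSH hm (h.periodCount_eq_zero hSH hm hq hl) hl⟩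
  have := hSH.curl_cut hm (val (m + 1) (c + 1))
  rw [← hq] at this
  omega

theorem succ (h : IsGluedAt m c q) (hSH : StandingHyp) (hm : 1 ≤ m)
    (hq : q < cut m (val (m + 1) (c + 1))) : IsGluedAt m c (q + 1) where
  gap := h.gap
  glue e s hs hlt := by
    by_cases h1 : piLen m e + 1 + s < piLen m c + 1 + q
    · exact h.glue e s hs h1
    have hmono := hSH.piLen_strictMono hm
    obtain rfl : e = c := by
      rcases lt_trichotomy e c with h2 | h2 | h2
      · have := h.gap e h2
        have := hmono.monotone (show e + 1 ≤ c from h2)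
        omega
      · exact h2
      · have := hmono.monotone (show c + 1 ≤ e from h2)
        have := h.le_piLen_succ hSH hm
        omega
    obtain rfl : s = q := by omega
    exact h.letter_of_lt hSH hm hq
  le_cut := hq

theorem next (h : IsGluedAt m c q) (hSH : StandingHyp) (hm : 1 ≤ m)
    (hq : q = cut m (val (m + 1) (c + 1))) : IsGluedAt m (c + 1) 0 := by
  have hmono := hSH.piLen_strictMono hm
  have hn : piLen m (c + 1) = piLen m c + 1 + q := by
    obtain ⟨e, he⟩ := exists_piLen_eq (h.letter_of_eq hSH hm hq)
    have h1 : c < e := hmono.lt_iff_lt.1 (by omega)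
    have h2 := hmono.monotone (show c + 1 ≤ e from h1)
    have h3 := h.le_piLen_succ hSH hm
    omega
  refine ⟨⟨fun e he => ?_, fun e s hs hlt => ?_⟩, Nat.zero_le _⟩
  · rcases Nat.lt_succ_iff_lt_or_eq.1 he with h1 | rfl
    · exact h.gap e h1
    · rw [hn, hq]
  · refine h.glue e s hs ?_
    have : e < c + 1 := hmono.lt_iff_lt.1 (by omega)
    rcases Nat.lt_succ_iff_lt_or_eq.1 this with h1 | rfl
    · have := h.gap e h1
      have := hmono.monotone (show e + 1 ≤ c from h1)
      omega
    · omega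

end IsGluedAt

theorem StandingHyp.isGluedAt (hSH : StandingHyp) (hm : 1 ≤ m) (c : ℕ) : IsGluedAt m c 0 := by
  have hmono := hSH.piLen_strictMono hm
  induction c with
  | zero =>
    refine ⟨⟨fun e he => absurd he (by omega), fun e s hs hlt => ?_⟩, Nat.zero_le _⟩
    have := hmono.monotone (Nat.zero_le e)
    omega
  | succ c ih =>
    have key (q : ℕ) (hq : q ≤ cut m (val (m + 1) (c + 1))) : IsGluedAt m c q := by
      induction q with
      | zero => exact ih
      | succ q ihq => exact (ihq (by omega)).succ hSH hm hq
    exact (key _ le_rfl).next hSH hm rfl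

/-- The structure theorem, as a recursion for the positions of `m` in `A^(m)`. -/
theorem StandingHyp.piLen_succ (hSH : StandingHyp) (hm : 1 ≤ m) (c : ℕ) :
    piLen m (c + 1) = piLen m c + 1 + cut m (val (m + 1) (c + 1)) :=
  (hSH.isGluedAt hm (c + 1)).gap c (Nat.lt_succ_self c)

end structureTheorem

theorem val_periodic_of_mod_lt {b x y : ℕ} (hb : 3 ≤ b) (hy : 0 < y) (hxy : (b - 1) * y ≤ x)
    (hx : ¬ b ∣ x) (hmod : ∀ w, x % b ^ (w + 1) < (b - 1) * b ^ w)
    (h : ∀ c, x < c + (b - 1) * y → c + y < x → val b c = val b (c + y)) :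
    b = 3 ∧ y = 1 ∧ 3 ∣ x - 1 ∧ 1 < x := by
  have hb2 : 2 ≤ b := by omega
  set w := val b y with hw
  have hwy : b ^ w ∣ y := (pow_dvd_iff_le_val hb2 hy).2 le_rfl
  have hndy : ¬ b ^ (w + 1) ∣ y := pow_val_succ_not_dvd hb2 hy
  have hndx : ¬ b ^ (w + 1) ∣ x := fun h0 => hx ((dvd_pow_self b (Nat.succ_ne_zero w)).trans h0)
  have hMle : (b - 1) * b ^ w ≤ (b - 1) * y := Nat.mul_le_mul_left _ (Nat.le_of_dvd hy hwy)
  have hyy : 2 * y ≤ (b - 1) * y := Nat.mul_le_mul_right _ (by omega)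
  have hR0 : 0 < x % b ^ (w + 1) := Nat.pos_of_ne_zero fun h0 => hndx (Nat.dvd_of_mod_eq_zero h0)
  have hR := hmod w
  have hdvd : b ^ (w + 1) ∣ x - x % b ^ (w + 1) := Nat.dvd_sub_mod x
  set c := x - x % b ^ (w + 1) with hc
  have hvc : w + 1 ≤ val b c := (pow_dvd_iff_le_val hb2 (by omega)).1 hdvd
  have h1 : x ≤ c + y := by
    by_contra hlt
    have := h c (by omega) (by omega)
    rw [this] at hvc
    exact hndy ((Nat.dvd_add_right hdvd).1 ((pow_dvd_iff_le_val hb2 (by omega)).2 hvc))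
  have hyc : y < c := by
    by_contra hle
    have hcy : c = y := by omega
    rw [hcy] at hdvd
    exact hndy hdvd
  have h2 : c + (b - 1) * y ≤ x + y := by
    by_contra hlt
    have := h (c - y) (by omega) (by omega)
    rw [Nat.sub_add_cancel hyc.le] at this
    rw [← this] at hvc
    have h5 := Nat.dvd_sub hdvd ((pow_dvd_iff_le_val hb2 (by omega)).2 hvc)
    rw [show c - (c - y) = y by omega] at h5
    exact hndy h5
  have hb3 : b = 3 := by
    have : (b - 1) * y ≤ 2 * y := by omega
    have := Nat.le_of_mul_le_mul_right this hy
    omega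
  subst hb3
  have hcxy : x = c + y := by omega
  have hwx : 3 ^ w ∣ x := by
    rw [hcxy]
    exact dvd_add ((pow_dvd_pow 3 (Nat.le_succ w)).trans hdvd) hwy
  have hw0 : w = 0 := by
    by_contra hne
    exact hx ((dvd_pow_self 3 hne).trans hwx)
  rw [hw0] at hR hR0 hdvd
  have hy1 : y = 1 := by
    rw [hw0] at hc
    norm_num at hR hR0 hc
    omega
  refine ⟨rfl, hy1, ?_, by omega⟩
  rw [show x - 1 = c by omega]
  simpa using hdvd

section density

variable {m : ℕ}

theorem StandingHyp.curl_piLen_succ_le (hSH : StandingHyp) (hm : 1 ≤ m) {x : ℕ}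
    (hx : ¬ (m + 2) ∣ x) (hmod : ∀ w, x % (m + 2) ^ (w + 1) < (m + 1) * (m + 2) ^ w) :
    curl (gPrefix (m + 1) (piLen (m + 1) x)) ≤ m := by
  obtain ⟨c, rfl⟩ : ∃ c, x = c + 1 := by
    refine ⟨x - 1, ?_⟩
    rcases x with _ | x
    · exact absurd (dvd_zero _) hx
    · rfl
  have hM : 1 ≤ m + 1 := by omega
  have h := hSH.isGluedAt hM c
  have hgap := hSH.piLen_succ hM
  have hmono := hSH.cut_strictMono hM
  have hv0 {z : ℕ} (hz0 : 0 < z) (hz : ¬ (m + 2) ∣ z) : cut (m + 1) (val (m + 1 + 1) z) = 0 := by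
    rw [← cut_zero hM]
    congr 1
    by_contra hne
    refine hz ?_
    simpa using (pow_dvd_iff_le_val (b := m + 2) (by omega) hz0).2
      (Nat.one_le_iff_ne_zero.2 hne)
  by_contra hlt
  rw [hgap, hv0 (by omega) hx] at hlt
  obtain ⟨l, hr⟩ := (le_curl_gPrefix_iff (k := m + 1) (by omega)).1
    (show m + 1 ≤ curl (gPrefix (m + 1) (piLen (m + 1) c + 1 + 0)) by omega)
  have hy : 0 < periodCount (letter (m + 1)) (m + 1) (piLen (m + 1) c + 1 + 0) l := by
    by_contra hy0
    have := (h.isRep_iff hSH hM (by omega) hr).2.1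
    nlinarith [hr.1]
  have hcount := h.count hSH hM
  have hmul := hr.mul_periodCount_le (m := m + 1)
  have hshift (e : ℕ) := hr.nth_add (m := m + 1) (by omega) (hSH.letter_infinite hM) (e := e)
  simp only [← piLen_eq, hcount] at hshift hmul
  set n := piLen (m + 1) c + 1 + 0 with hn
  set y := periodCount (letter (m + 1)) (m + 1) n l with hydef
  obtain ⟨hm1, hy1, h3, hc⟩ := val_periodic_of_mod_lt (b := m + 1 + 1) (by omega) hy hmul hx hmod
    (fun d h1 h2 => by
      obtain ⟨e, rfl⟩ : ∃ e, d = e + 1 := by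
        refine ⟨d - 1, ?_⟩
        rcases d with _ | d
        · rw [Nat.add_sub_cancel] at h1; omega
        · rfl
      rw [Nat.add_sub_cancel] at h1
      obtain ⟨-, -, a1⟩ := hshift e (by omega) (by omega)
      obtain ⟨-, -, a2⟩ := hshift (e + 1) (by omega) (by omega)
      have a3 := hgap e
      have a4 := hgap (e + y)
      rw [show e + 1 + y = e + y + 1 by omega] at a2 ⊢
      exact hmono.injective (by omega))
  obtain rfl : m = 1 := by omega
  rw [Nat.add_sub_cancel] at h3
  obtain ⟨f, rfl⟩ : ∃ f, c = f + 2 := ⟨c - 2, by have := Nat.le_of_dvd (by omega) h3; omega⟩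
  obtain ⟨a1, a2, a3⟩ := hshift (f + 1) (by rw [hy1]) (by rw [hy1]; omega)
  rw [hy1] at a3
  have a4 := hgap (f + 1)
  have a5 := hgap f
  rw [hv0 (by omega) (by omega)] at a5
  have a6 : 0 < cut (1 + 1) (val (1 + 1 + 1) (f + 1 + 1)) := by
    rw [← cut_zero hM]
    refine hmono ((pow_dvd_iff_le_val (by omega) (by omega)).1 ?_)
    simpa using h3
  have a8 : n = piLen (1 + 1) (f + 1 + 1) + 1 := hn
  have a7 := hr.2.2 (piLen (1 + 1) f) (by omega) (by omega)
  rw [hSH.letter_piLen hM, show piLen (1 + 1) f + l = piLen (1 + 1) (f + 1) + 1 + (l - 2) by omega,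
    h.glue (f + 1) (l - 2) (by omega) (by omega)] at a7
  exact letter_succ_ne _ _ a7.symm

end density

section expansion

variable {b : ℕ}

theorem chi_eq (hb : 2 ≤ b) (h : ℕ) : chi b h = h % b + (b + 1) * chi b (h / b) := by
  rcases Nat.eq_zero_or_pos h with rfl | hh
  · simp [chi]
  · unfold chi
    rw [Nat.digits_def' (by omega) hh, Nat.ofDigits_cons]

theorem chi_strictMono (hb : 2 ≤ b) : StrictMono (chi b) := by
  intro a h hah
  induction h using Nat.strong_induction_on generalizing a with
  | _ h ih =>
    rw [chi_eq hb a, chi_eq hb h]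
    have ha := Nat.mod_lt a (show 0 < b by omega)
    have h1 := Nat.div_add_mod a b
    have h2 := Nat.div_add_mod h b
    rcases (Nat.div_le_div_right (c := b) hah.le).lt_or_eq with h3 | h3
    · have := Nat.mul_le_mul_left (b + 1)
        (Nat.succ_le_of_lt (ih (h / b) (Nat.div_lt_self (by omega) (by omega)) h3))
      rw [Nat.succ_eq_add_one, mul_add, mul_one] at this
      omega
    · rw [h3] at h1 ⊢
      omega

theorem chi_le_sq (hb : 2 ≤ b) (h : ℕ) : chi b h ≤ h ^ 2 := by
  induction h using Nat.strong_induction_on with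
  | _ h ih =>
    rcases Nat.eq_zero_or_pos h with rfl | hh
    · simp [chi]
    · rw [chi_eq hb]
      have h1 := ih _ (Nat.div_lt_self hh (show 1 < b by omega))
      have h2 := Nat.div_add_mod h b
      generalize h % b = r at *
      generalize h / b = q at *
      subst h2
      have h3 : r ≤ r ^ 2 := Nat.le_self_pow (by omega) r
      have h4 : (b + 1) * chi b q ≤ b ^ 2 * q ^ 2 := Nat.mul_le_mul (by nlinarith) h1
      nlinarith [Nat.zero_le (b * q * r)]

theorem chi_lt_pow (hb : 2 ≤ b) (h : ℕ) : chi b h < (b + 1) ^ h := by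
  induction h using Nat.strong_induction_on with
  | _ h ih =>
    rcases Nat.eq_zero_or_pos h with rfl | hh
    · simp [chi]
    · rw [chi_eq hb]
      have h0 := Nat.div_lt_self hh (show 1 < b by omega)
      have h1 := ih _ h0
      have h2 := Nat.mod_lt h (show 0 < b by omega)
      have h3 : (b + 1) ^ (h / b + 1) ≤ (b + 1) ^ h := Nat.pow_le_pow_right (by omega) h0
      rw [pow_succ] at h3
      nlinarith

theorem add_mul_mod_lt {r q : ℕ} (hr : r < b)
    (hq : ∀ w, q % (b + 1) ^ (w + 1) < b * (b + 1) ^ w) (w : ℕ) :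
    (r + (b + 1) * q) % (b + 1) ^ (w + 1) < b * (b + 1) ^ w := by
  rw [pow_succ', Nat.mod_mul, Nat.add_mul_mod_self_left, Nat.mod_eq_of_lt (by omega : r < b + 1),
    Nat.add_mul_div_left _ _ (by omega), Nat.div_eq_of_lt (by omega : r < b + 1), zero_add]
  rcases w with _ | w
  · simpa [Nat.mod_one] using hr
  · have := Nat.mul_le_mul_left (b + 1) (Nat.succ_le_of_lt (hq w))
    rw [Nat.succ_eq_add_one, mul_add, mul_left_comm, ← pow_succ'] at this
    linarith

theorem chi_mod_lt (hb : 2 ≤ b) (h w : ℕ) :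
    chi b h % (b + 1) ^ (w + 1) < b * (b + 1) ^ w := by
  induction h using Nat.strong_induction_on generalizing w with
  | _ h ih =>
    rcases Nat.eq_zero_or_pos h with rfl | hh
    · simp [chi]; omega
    · rw [chi_eq hb]
      exact add_mul_mod_lt (Nat.mod_lt h (by omega))
        (ih _ (Nat.div_lt_self hh (show 1 < b by omega))) w

/-- The `i`-th number without digit `m + 1` in base `m + 2` and with last digit nonzero. -/
def sparse (m i : ℕ) : ℕ := i % m + 1 + (m + 1 + 1) * chi (m + 1) (i / m)

variable {m : ℕ}

theorem sparse_strictMono (hm : 1 ≤ m) : StrictMono (sparse m) := by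
  intro a h hah
  unfold sparse
  have ha := Nat.mod_lt a (show 0 < m by omega)
  have h1 := Nat.div_add_mod a m
  have h2 := Nat.div_add_mod h m
  rcases (Nat.div_le_div_right (c := m) hah.le).lt_or_eq with h3 | h3
  · have := Nat.mul_le_mul_left (m + 1 + 1)
      (Nat.succ_le_of_lt (chi_strictMono (show 2 ≤ m + 1 by omega) h3))
    rw [Nat.succ_eq_add_one, mul_add, mul_one] at this
    omega
  · rw [h3] at h1 ⊢
    omega

theorem not_dvd_sparse (hm : 1 ≤ m) (i : ℕ) : ¬ (m + 2) ∣ sparse m i := by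
  have := Nat.mod_lt i (show 0 < m by omega)
  rw [sparse, Nat.dvd_add_left ⟨_, rfl⟩]
  exact Nat.not_dvd_of_pos_of_lt (by omega) (by omega)

theorem sparse_mod_lt (hm : 1 ≤ m) (i w : ℕ) :
    sparse m i % (m + 2) ^ (w + 1) < (m + 1) * (m + 2) ^ w :=
  add_mul_mod_lt (by have := Nat.mod_lt i (show 0 < m by omega); omega)
    (chi_mod_lt (by omega) _) w

theorem sparse_lt_pow (hm : 1 ≤ m) (i : ℕ) : sparse m i < (m + 2) ^ (i + 1) := by
  have h1 := chi_lt_pow (show 2 ≤ m + 1 by omega) (i / m)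
  have h2 := Nat.mod_lt i (show 0 < m by omega)
  have h3 : (m + 1 + 1) ^ (i / m) ≤ (m + 2) ^ i :=
    Nat.pow_le_pow_right (by omega) (Nat.div_le_self i m)
  rw [pow_succ]
  unfold sparse
  nlinarith

theorem sparse_one_le (i : ℕ) : sparse 1 i ≤ 3 * i ^ 2 + 1 := by
  have : chi (1 + 1) i ≤ i ^ 2 := chi_le_sq le_rfl i
  simp only [sparse, Nat.mod_one, Nat.div_one]
  omega

theorem sparse_le (hm : 2 ≤ m) (i : ℕ) : sparse m i ≤ i ^ 2 + 1 := by
  have h1 := chi_le_sq (show 2 ≤ m + 1 by omega) (i / m)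
  have h2 := Nat.div_add_mod i m
  unfold sparse
  generalize i % m = r at *
  generalize i / m = q at *
  subst h2
  have h3 : r ≤ r ^ 2 := Nat.le_self_pow (by omega) r
  have h4 : (m + 1 + 1) * chi (m + 1) q ≤ m ^ 2 * q ^ 2 := Nat.mul_le_mul (by nlinarith) h1
  nlinarith [Nat.zero_le (m * q * r)]

theorem StandingHyp.cut_succ_le (hSH : StandingHyp) (hm : 1 ≤ m) (i : ℕ) :
    cut m (i + 1) ≤ piLen (m + 1) (sparse m i) := by
  have hcut := hSH.cut_strictMono hm
  have hmono := (hSH.piLen_strictMono (show 1 ≤ m + 1 by omega)).comp (sparse_strictMono hm)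
  obtain ⟨v, hv⟩ := exists_cut_eq (hSH.curl_piLen_succ_le hm (not_dvd_sparse hm i)
    (sparse_mod_lt hm i))
  induction i generalizing v with
  | zero =>
    have h1 := hSH.piLen_strictMono (show 1 ≤ m + 1 by omega)
      (show 0 < sparse m 0 by unfold sparse; omega)
    rw [piLen_zero (by omega), ← hv, ← cut_zero hm] at h1
    rw [← hv]
    exact hcut.monotone (hcut.lt_iff_lt.1 h1)
  | succ i ih =>
    obtain ⟨u, hu⟩ := exists_cut_eq (hSH.curl_piLen_succ_le hm (not_dvd_sparse hm i)
      (sparse_mod_lt hm i))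
    have h1 := (ih u hu).trans_lt (hmono (show i < i + 1 by omega))
    simp only [Function.comp_apply] at h1
    rw [← hv] at h1 ⊢
    exact hcut.monotone (hcut.lt_iff_lt.1 h1)

end expansion

section growth

variable {m : ℕ}

theorem val_le_of_lt_pow {b x J : ℕ} (hb : 2 ≤ b) (hx : 0 < x) (h : x < b ^ (J + 1)) :
    val b x ≤ J :=
  Nat.lt_succ_iff.1 ((Nat.pow_lt_pow_iff_right (by omega : 1 < b)).1 ((pow_val_le hb hx).trans_lt h))

theorem StandingHyp.piLen_eq_sum (hSH : StandingHyp) (hm : 1 ≤ m) {x J : ℕ}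
    (hx : x < (m + 1) ^ (J + 1)) :
    piLen m x = x + ∑ i ∈ Finset.range J, (cut m (i + 1) - cut m i) * (x / (m + 1) ^ (i + 1)) := by
  induction x with
  | zero => simp [piLen_zero hm]
  | succ x ih =>
    have hv : val (m + 1) (x + 1) ≤ J := val_le_of_lt_pow (by omega) (Nat.succ_pos x) hx
    have key : cut m (val (m + 1) (x + 1)) = ∑ i ∈ Finset.range J,
        (cut m (i + 1) - cut m i) * if (m + 1) ^ (i + 1) ∣ x + 1 then 1 else 0 := by
      simp only [mul_ite, mul_one, mul_zero, ← Finset.sum_filter]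
      rw [show (Finset.range J).filter (fun i => (m + 1) ^ (i + 1) ∣ x + 1) =
          Finset.range (val (m + 1) (x + 1)) by
        ext i
        rw [Finset.mem_filter, Finset.mem_range, Finset.mem_range,
          pow_dvd_iff_le_val (by omega) (by omega)]
        omega, Finset.sum_range_tsub (hSH.cut_strictMono hm).monotone, cut_zero hm, Nat.sub_zero]
    rw [hSH.piLen_succ hm, ih (by omega), key]
    simp only [Nat.succ_div, mul_add, Finset.sum_add_distrib]
    omega

/-- The ratio `piLen m ((m + 1) ^ J) / (m + 1) ^ J`. -/
noncomputable def ratio (m J : ℕ) : ℝ :=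
  1 + ∑ i ∈ Finset.range J, ((cut m (i + 1) - cut m i : ℕ) : ℝ) / ((m : ℝ) + 1) ^ (i + 1)

theorem ratio_zero (m : ℕ) : ratio m 0 = 1 := by simp [ratio]

theorem ratio_succ (m J : ℕ) : ratio m (J + 1) =
    ratio m J + ((cut m (J + 1) - cut m J : ℕ) : ℝ) / ((m : ℝ) + 1) ^ (J + 1) := by
  rw [ratio, Finset.sum_range_succ, ← add_assoc]; rfl

theorem ratio_monotone (m : ℕ) : Monotone (ratio m) :=
  monotone_nat_of_le_succ fun J => by
    rw [ratio_succ]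
    exact le_add_of_nonneg_right (by positivity)

theorem StandingHyp.piLen_le (hSH : StandingHyp) (hm : 1 ≤ m) {x J : ℕ}
    (hx : x < (m + 1) ^ (J + 1)) : (piLen m x : ℝ) ≤ x * ratio m J := by
  rw [hSH.piLen_eq_sum hm hx, ratio, mul_add, mul_one, Finset.mul_sum, Nat.cast_add, Nat.cast_sum]
  refine add_le_add_right (Finset.sum_le_sum fun i _ => ?_) _
  have : ((x / (m + 1) ^ (i + 1) : ℕ) : ℝ) ≤ x / ((m : ℝ) + 1) ^ (i + 1) := by
    simpa using Nat.cast_div_le (α := ℝ) (m := x) (n := (m + 1) ^ (i + 1))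
  rw [Nat.cast_mul, mul_div_left_comm]
  gcongr

theorem StandingHyp.piLen_pow (hSH : StandingHyp) (hm : 1 ≤ m) (J : ℕ) :
    (piLen m ((m + 1) ^ J) : ℝ) = ((m : ℝ) + 1) ^ J * ratio m J := by
  rw [hSH.piLen_eq_sum hm (Nat.pow_lt_pow_right (by omega) (Nat.lt_succ_self J)), ratio, mul_add,
    mul_one, Finset.mul_sum, Nat.cast_add, Nat.cast_sum]
  congr 1
  · push_cast; rfl
  refine Finset.sum_congr rfl fun i hi => ?_
  have hd : (m + 1) ^ (i + 1) ∣ (m + 1) ^ J := pow_dvd_pow _ (Finset.mem_range.1 hi)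
  rw [Nat.cast_mul, Nat.cast_div hd (by positivity), mul_div_left_comm]
  push_cast
  rfl

theorem StandingHyp.cut_succ_le_mul (hSH : StandingHyp) (hm : 1 ≤ m) {j : ℕ} {C : ℝ}
    (hC : ratio (m + 1) j ≤ C) : (cut m (j + 1) : ℝ) ≤ sparse m j * C :=
  calc (cut m (j + 1) : ℝ) ≤ piLen (m + 1) (sparse m j) := by exact_mod_cast hSH.cut_succ_le hm j
    _ ≤ sparse m j * ratio (m + 1) j := hSH.piLen_le (by omega) (sparse_lt_pow hm j)
    _ ≤ sparse m j * C := by gcongr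

/-- The length of the word of ratio `ratio m (j + 1)` without its last glue word. -/
noncomputable def trunc (m j : ℕ) : ℝ :=
  ((m : ℝ) + 1) ^ (j + 1) * ratio m (j + 1) - cut m (j + 1)

theorem StandingHyp.trunc_zero (hSH : StandingHyp) (hm : 1 ≤ m) : trunc m 0 = m + 1 := by
  have := (hSH.cut_strictMono hm).monotone (show 0 ≤ 0 + 1 by omega)
  have h0 : (m : ℝ) + 1 ≠ 0 := by positivity
  rw [trunc, ratio_succ, ratio_zero, Nat.cast_sub this, cut_zero hm]
  field_simp
  simp

theorem StandingHyp.trunc_succ (hSH : StandingHyp) (hm : 1 ≤ m) (j : ℕ) :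
    trunc m (j + 1) = (m + 1) * trunc m j + m * cut m (j + 1) := by
  have := (hSH.cut_strictMono hm).monotone (show j + 1 ≤ j + 1 + 1 by omega)
  have h0 : (m : ℝ) + 1 ≠ 0 := by positivity
  rw [trunc, ratio_succ, Nat.cast_sub this, trunc]
  field_simp
  ring

theorem ratio_succ_le {j : ℕ} {C : ℝ} (h : trunc m j + cut m (j + 1) ≤ C * ((m : ℝ) + 1) ^ (j + 1)) :
    ratio m (j + 1) ≤ C := by
  have h0 : 0 < ((m : ℝ) + 1) ^ (j + 1) := by positivity
  rw [trunc] at h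
  refine le_of_mul_le_mul_right ?_ h0
  linarith

theorem StandingHyp.ratio_le_three (hSH : StandingHyp) (hm : 2 ≤ m) (j : ℕ) : ratio m j ≤ 3 := by
  have cut_le {m j : ℕ} (hm : 2 ≤ m) (h : ratio (m + 1) j ≤ 3) :
      (cut m (j + 1) : ℝ) ≤ 3 * ((j : ℝ) ^ 2 + 1) := by
    have h1 := hSH.cut_succ_le_mul (by omega) h
    have h2 : (sparse m j : ℝ) ≤ (j : ℝ) ^ 2 + 1 := by exact_mod_cast sparse_le hm j
    linarith
  suffices ∀ m, 2 ≤ m →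
      trunc m j + 3 * ((j : ℝ) ^ 2 + j + 2) ≤ 3 * ((m : ℝ) + 1) ^ (j + 1) ∧ ratio m j ≤ 3 from
    (this m hm).2
  induction j with
  | zero =>
    intro m hm
    have : (2 : ℝ) ≤ m := by exact_mod_cast hm
    rw [hSH.trunc_zero (by omega), ratio_zero]
    constructor
    · norm_num; linarith
    · norm_num
  | succ j ih =>
    intro m hm
    have hm' : (2 : ℝ) ≤ m := by exact_mod_cast hm
    have h1 := (ih m hm).1
    have h2 := cut_le hm (ih (m + 1) (by omega)).2
    have hj : (0 : ℝ) ≤ j := j.cast_nonneg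
    refine ⟨?_, ratio_succ_le (by linarith)⟩
    rw [hSH.trunc_succ (by omega), pow_succ _ (j + 1)]
    push_cast
    have h3 := mul_le_mul_of_nonneg_left h1 (show (0 : ℝ) ≤ m + 1 by positivity)
    have h4 := mul_le_mul_of_nonneg_left h2 (show (0 : ℝ) ≤ m by positivity)
    have h5 := mul_nonneg (show (0 : ℝ) ≤ m - 2 by linarith) (show (0 : ℝ) ≤ j + 1 by positivity)
    nlinarith

theorem StandingHyp.ratio_one_le (hSH : StandingHyp) (j : ℕ) : ratio 1 j ≤ 16 := by
  have cut_le (j : ℕ) : (cut 1 (j + 1) : ℝ) ≤ 3 * (3 * (j : ℝ) ^ 2 + 1) := by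
    have h1 := hSH.cut_succ_le_mul le_rfl (hSH.ratio_le_three le_rfl j)
    have h2 : (sparse 1 j : ℝ) ≤ 3 * (j : ℝ) ^ 2 + 1 := by exact_mod_cast sparse_one_le j
    linarith
  have trunc_le (j : ℕ) :
      trunc 1 j + (9 * (j : ℝ) ^ 2 + 18 * j + 30) ≤ 16 * (((1 : ℕ) : ℝ) + 1) ^ (j + 1) := by
    induction j with
    | zero => rw [hSH.trunc_zero le_rfl]; norm_num
    | succ j ih =>
      have := cut_le j
      rw [hSH.trunc_succ le_rfl, pow_succ _ (j + 1)]
      push_cast at *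
      nlinarith
  rcases j with _ | j
  · rw [ratio_zero]; norm_num
  · refine ratio_succ_le ?_
    have := cut_le j
    have := trunc_le j
    have : (0 : ℝ) ≤ j := j.cast_nonneg
    linarith

theorem StandingHyp.ratio_le (hSH : StandingHyp) (hm : 1 ≤ m) (j : ℕ) : ratio m j ≤ 16 := by
  rcases hm.eq_or_lt with rfl | h
  · exact hSH.ratio_one_le j
  · exact (hSH.ratio_le_three h j).trans (by norm_num)

end growth

/-- Theorem `epsilonm`. For every `m ≥ 1` there is a real `ε_m` with
`0 < ε_m < 20` such that `β^(m)(t)/(m+1)^{t−1} → ε_m`. -/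
theorem statement14 (hSH : StandingHyp) (m : ℕ) (hm : 1 ≤ m) :
    ∃ ε : ℝ, 0 < ε ∧ ε < 20 ∧
      Tendsto (fun t : ℕ => (beta m t : ℝ) / ((m : ℝ) + 1) ^ (t - 1)) atTop (nhds ε) := by
  have hbdd : BddAbove (Set.range (ratio m)) :=
    ⟨16, Set.forall_mem_range.2 (hSH.ratio_le hm)⟩
  refine ⟨⨆ j, ratio m j, ?_, ?_, ?_⟩
  · have := le_ciSup hbdd 0
    rw [ratio_zero] at this
    linarith
  · have := ciSup_le (hSH.ratio_le hm)
    linarith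
  · refine ((tendsto_atTop_ciSup (ratio_monotone m) hbdd).comp (tendsto_sub_atTop_nat 1)).congr
      fun t => ?_
    rw [Function.comp_apply, beta, hSH.piLen_pow hm, mul_div_cancel_left₀ _ (by positivity)]
end
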